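/- arXiv:1803.06264 — 3 statements merged into one kernel-verified Lean document; each statement's English description precedes it below -/
import Mathlib

section
/- Let q, p ∈ ℕ ∪ {∞} and let f be a continuous function which is positive definite on Ω_{2q} × Ω_{2p}, with coefficient index set J = {(m,n,k,l) ∈ ℤ₊⁴ : a_{m,n,k,l} > 0} in its expansion in products of disc polynomials, and let J' = {(m−n, k−l) ∈ ℤ² : (m,n,k,l) ∈ J}. If J' ∩ (Nℤ+x) × (Mℤ+y) ≠ ∅ for every positive integers N, M, x, y, then f is strictly positive definite on Ω_{2q} × Ω_{2p}. -/
open scoped ComplexOrder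

noncomputable section

/-- The Hilbert space ℓ²(ℂ) of square–summable complex sequences. -/
abbrev Ell2 : Type := lp (fun _ : ℕ => ℂ) 2

/-- The Hermitian inner product of the paper: `hdot z w = z·w = Σ_j z_j conj(w_j)`. -/
def hdot (z w : Ell2) : ℂ := @inner ℂ _ _ w z

/-- The sphere `Ω_{2q}` (for `q : ℕ∞`), viewed inside ℓ²(ℂ): the unit vectors supported
on the first `q` coordinates; for `q = ⊤` this is the unit sphere `Ω_∞` of ℓ²(ℂ). -/
def Omega (q : ℕ∞) : Set Ell2 :=
  {z | ‖z‖ = 1 ∧ ∀ j : ℕ, q ≤ (j : ℕ∞) → z j = 0}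

/-- A kernel `K` is positive definite on a set `S`. -/
def IsPDKernel {α : Type*} (S : Set α) (K : α → α → ℂ) : Prop :=
  ∀ (L : ℕ) (x : Fin L → α), (∀ i, x i ∈ S) → Function.Injective x →
    ∀ c : Fin L → ℂ, 0 ≤ ∑ μ, ∑ ν, c μ * (starRingEnd ℂ) (c ν) * K (x μ) (x ν)

/-- A kernel `K` is strictly positive definite on a set `S`. -/
def IsSPDKernel {α : Type*} (S : Set α) (K : α → α → ℂ) : Prop :=
  IsPDKernel S K ∧
    ∀ (L : ℕ) (x : Fin L → α), (∀ i, x i ∈ S) → Function.Injective x →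
      ∀ c : Fin L → ℂ,
        ∑ μ, ∑ ν, c μ * (starRingEnd ℂ) (c ν) * K (x μ) (x ν) = 0 → c = 0

/-- `f` is positive definite on `Ω_{2q} × Ω_{2p}`. -/
def PDonProd (q p : ℕ∞) (f : ℂ → ℂ → ℂ) : Prop :=
  IsPDKernel ((Omega q) ×ˢ (Omega p))
    (fun x y => f (hdot x.1 y.1) (hdot x.2 y.2))

/-- `f` is strictly positive definite on `Ω_{2q} × Ω_{2p}`. -/
def SPDonProd (q p : ℕ∞) (f : ℂ → ℂ → ℂ) : Prop :=
  IsSPDKernel ((Omega q) ×ˢ (Omega p))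
    (fun x y => f (hdot x.1 y.1) (hdot x.2 y.2))

/-- `g` is positive definite on `Ω_{2q}`. -/
def PDonSphere (q : ℕ∞) (g : ℂ → ℂ) : Prop :=
  IsPDKernel (Omega q) (fun z z' => g (hdot z z'))

/-- The Jacobi polynomial of degree `k` with (integer) parameters `α, β`, normalized
so that its value at `1` is `1`. -/
def jacobiR (α β k : ℕ) (x : ℝ) : ℝ :=
  (∑ s ∈ Finset.range (k + 1),
      ((k + α).choose (k - s) : ℝ) * ((k + β).choose s : ℝ) *
        ((x - 1) / 2) ^ s * ((x + 1) / 2) ^ (k - s)) /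
    ((k + α).choose k : ℝ)

/-- The disc polynomial `R_{m,n}^{q-2}`; for `q = ⊤` (and also `q = 1`) it is
`ξ^m conj(ξ)^n`.  For `2 ≤ q < ⊤` it equals
`r^{|m-n|} e^{i(m-n)φ} R_{min(m,n)}^{(q-2,|m-n|)}(2r²-1)` for `ξ = r e^{iφ}`. -/
def discR (q : ℕ∞) (m n : ℕ) (ξ : ℂ) : ℂ :=
  if q = ⊤ ∨ q ≤ 1 then ξ ^ m * (starRingEnd ℂ ξ) ^ n
  else (if n ≤ m then ξ ^ (m - n) else (starRingEnd ℂ ξ) ^ (n - m)) *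
    ((jacobiR (q.toNat - 2) (max m n - min m n) (min m n)
        (2 * ‖ξ‖ ^ 2 - 1) : ℝ) : ℂ)

/-- The natural domain `𝔻̃`: the unit circle `∂𝔻` when `q = 1` (the sphere `Ω₂`),
the closed unit disc `𝔻` otherwise. -/
def domD (q : ℕ∞) : Set ℂ :=
  if q = 1 then Metric.sphere (0 : ℂ) 1 else Metric.closedBall (0 : ℂ) 1

/-- `A ⊆ ℤ²` intersects every product of full arithmetic progressions in ℤ. -/
def MeetsAllProgressions (A : Set (ℤ × ℤ)) : Prop :=
  ∀ N M x y : ℤ, 0 < N → 0 < M → 0 < x → 0 < y →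
    ∃ v ∈ A, (∃ j : ℤ, v.1 = N * j + x) ∧ (∃ j : ℤ, v.2 = M * j + y)

/-- The ring of integers is a Jacobson ring. -/
theorem isJacobsonRing_int : IsJacobsonRing ℤ := by
  rw [isJacobsonRing_iff_prime_eq]
  intro P hP
  by_cases hP0 : P = ⊥
  · subst hP0
    refine le_antisymm (fun x hx => ?_) Ideal.le_jacobson
    rw [Ideal.mem_jacobson_bot] at hx
    have h1 := Int.isUnit_iff.1 (hx 3)
    have h2 := Int.isUnit_iff.1 (hx 1)
    have : x = 0 := by omega
    simp [this]
  · have := hP.isMaximal hP0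
    exact Ideal.jacobson_eq_self_of_isMaximal

/-- A field of finite type over `ℤ` is finite. -/
theorem finite_of_finiteType_int (K : Type*) [Field K] [inst : Algebra ℤ K]
    [hK : Algebra.FiniteType ℤ K] : Finite K := by
  obtain rfl : inst = Ring.toIntAlgebra K := Subsingleton.elim _ _
  have := isJacobsonRing_int
  have hfin : Module.Finite ℤ K := finite_of_finite_type_of_isJacobsonRing ℤ K
  have hnz : ∃ n : ℤ, n ≠ 0 ∧ (n : K) = 0 := by
    by_contra! h
    have hinj : Function.Injective (algebraMap ℤ K) := by
      rw [injective_iff_map_eq_zero]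
      intro n hn
      by_contra hne
      exact h n hne (by simpa using hn)
    exact Int.not_isField (isField_of_isIntegral_of_isField hinj (Field.toIsField K))
  obtain ⟨n, hn, hn0⟩ := hnz
  apply Module.finite_of_fg_torsion K
  intro x
  exact ⟨⟨n, mem_nonZeroDivisors_of_ne_zero hn⟩, by
    simp [Submonoid.smul_def, hn0]⟩

/-- A nonzero value of an exponential sum with unit bases persists along a full product of
arithmetic progressions. -/
theorem exists_progression_expSum_ne_zero {ι : Type*} (S : Finset ι) {F : Type*} [Field F]
    (c u v : ι → F) (hu : ∀ i, u i ≠ 0) (hv : ∀ i, v i ≠ 0) (s₀ t₀ : ℤ)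
    (h : ∑ i ∈ S, c i * u i ^ s₀ * v i ^ t₀ ≠ 0) :
    ∃ N : ℕ, 0 < N ∧ ∀ j k : ℤ,
      ∑ i ∈ S, c i * u i ^ (s₀ + N * j) * v i ^ (t₀ + N * k) ≠ 0 := by
  classical
  set d := ∑ i ∈ S, c i * u i ^ s₀ * v i ^ t₀ with hd
  set G : Set F := ({d⁻¹} : Set F) ∪ ((c '' S) ∪ ((u '' S) ∪ ((fun i => (u i)⁻¹) '' S)) ∪
    ((v '' S) ∪ ((fun i => (v i)⁻¹) '' S))) with hG
  have hGfin : G.Finite := by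
    have hS := S.finite_toSet
    exact (Set.finite_singleton _).union
      (((hS.image _).union ((hS.image _).union (hS.image _))).union
        ((hS.image _).union (hS.image _)))
  let A := Algebra.adjoin ℤ G
  have hA : Algebra.FiniteType ℤ A := Algebra.FiniteType.adjoin_of_finite hGfin
  have hsub : ∀ x ∈ G, x ∈ A := fun x hx => Algebra.subset_adjoin hx
  have hcA : ∀ i ∈ S, c i ∈ A := fun i hi => hsub _ (by
    refine Or.inr (Or.inl (Or.inl ⟨i, hi, rfl⟩)))
  have huA : ∀ i ∈ S, u i ∈ A := fun i hi => hsub _ (by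
    refine Or.inr (Or.inl (Or.inr (Or.inl ⟨i, hi, rfl⟩))))
  have huA' : ∀ i ∈ S, (u i)⁻¹ ∈ A := fun i hi => hsub _ (by
    refine Or.inr (Or.inl (Or.inr (Or.inr ⟨i, hi, rfl⟩))))
  have hvA : ∀ i ∈ S, v i ∈ A := fun i hi => hsub _ (by
    refine Or.inr (Or.inr (Or.inl ⟨i, hi, rfl⟩)))
  have hvA' : ∀ i ∈ S, (v i)⁻¹ ∈ A := fun i hi => hsub _ (by
    refine Or.inr (Or.inr (Or.inr ⟨i, hi, rfl⟩)))
  have hdA : d⁻¹ ∈ A := hsub _ (Or.inl rfl)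
  obtain ⟨m, hm⟩ := Ideal.exists_maximal A
  let _ : Field (A ⧸ m) := Ideal.Quotient.field m
  have hK : Algebra.FiniteType ℤ (A ⧸ m) :=
    Algebra.FiniteType.of_surjective (Ideal.Quotient.mkₐ ℤ m) (Ideal.Quotient.mkₐ_surjective ℤ m)
  have hKfin : Finite (A ⧸ m) := finite_of_finiteType_int (A ⧸ m)
  let π : A →+* (A ⧸ m) := Ideal.Quotient.mk m
  let C : S → A := fun i => ⟨c i, hcA i i.2⟩
  let U : S → Aˣ := fun i => ⟨⟨u i, huA i i.2⟩, ⟨(u i)⁻¹, huA' i i.2⟩,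
    Subtype.ext (mul_inv_cancel₀ (hu i)), Subtype.ext (inv_mul_cancel₀ (hu i))⟩
  let V : S → Aˣ := fun i => ⟨⟨v i, hvA i i.2⟩, ⟨(v i)⁻¹, hvA' i i.2⟩,
    Subtype.ext (mul_inv_cancel₀ (hv i)), Subtype.ext (inv_mul_cancel₀ (hv i))⟩
  let E : ℤ → ℤ → A := fun s t => ∑ i, C i * (U i ^ s : Aˣ) * (V i ^ t : Aˣ)
  have hcoe : ∀ (w : Aˣ) (s : ℤ), (((w ^ s : Aˣ) : A) : F) = ((w : A) : F) ^ s := by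
    intro w s
    have := map_zpow (Units.map (A.val : A →* F)) w s
    exact (congrArg Units.val this).trans (Units.val_zpow_eq_zpow_val _ _)
  have hE : ∀ s t, ((E s t : A) : F) = ∑ i ∈ S, c i * u i ^ s * v i ^ t := by
    intro s t
    rw [← Finset.sum_coe_sort S]
    simp only [E, AddSubmonoidClass.coe_finsetSum, MulMemClass.coe_mul, hcoe, C, U, V]
  let N := Nat.card (A ⧸ m)ˣ
  have hNpos : 0 < N := Nat.card_pos
  have hred : ∀ (w : Aˣ) (s j : ℤ), π ((w ^ (s + N * j) : Aˣ) : A) = π ((w ^ s : Aˣ) : A) := by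
    intro w s j
    have : Units.map (π : A →* A ⧸ m) (w ^ (s + N * j)) = Units.map (π : A →* A ⧸ m) (w ^ s) := by
      rw [map_zpow, map_zpow, zpow_add, zpow_mul, zpow_natCast, pow_card_eq_one', one_zpow, mul_one]
    exact congrArg Units.val this
  refine ⟨N, hNpos, fun j k h0 => ?_⟩
  have h1 : E (s₀ + N * j) (t₀ + N * k) = 0 := Subtype.ext (by rw [hE, h0]; rfl)
  have h2 : π (E s₀ t₀) = 0 := by
    rw [← map_zero π, ← h1]
    simp only [E, map_sum, map_mul, hred]
  have h3 : E s₀ t₀ * ⟨d⁻¹, hdA⟩ = 1 := Subtype.ext (by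
    simp only [MulMemClass.coe_mul, hE, OneMemClass.coe_one]
    exact mul_inv_cancel₀ h)
  have h4 := congrArg π h3
  rw [map_mul, h2, zero_mul, map_one] at h4
  exact zero_ne_one h4

/-- Distinct characters `(s, t) ↦ u ^ s * v ^ t` of `ℤ²` are linearly independent. -/
theorem exists_expSum_ne_zero {ι : Type*} (S : Finset ι) {F : Type*} [Field F]
    (c u v : ι → F) (hu : ∀ i, u i ≠ 0) (hv : ∀ i, v i ≠ 0)
    (hinj : ∀ i ∈ S, ∀ j ∈ S, u i = u j → v i = v j → i = j) {i₀ : ι} (hi₀ : i₀ ∈ S)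
    (hc : c i₀ ≠ 0) : ∃ s t : ℤ, ∑ i ∈ S, c i * u i ^ s * v i ^ t ≠ 0 := by
  by_contra! h
  let χ : S → (Multiplicative (ℤ × ℤ) →* F) := fun i =>
    { toFun := fun g => u i ^ g.toAdd.1 * v i ^ g.toAdd.2
      map_one' := by simp
      map_mul' := fun a b => by
        simp only [toAdd_mul, Prod.fst_add, Prod.snd_add, zpow_add₀ (hu i), zpow_add₀ (hv i)]
        ring }
  have hχ : Function.Injective χ := by
    intro i j hij
    have h1 := DFunLike.congr_fun hij (Multiplicative.ofAdd (1, 0))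
    have h2 := DFunLike.congr_fun hij (Multiplicative.ofAdd (0, 1))
    exact Subtype.ext (hinj i i.2 j j.2 (by simpa [χ] using h1) (by simpa [χ] using h2))
  have hli := (linearIndependent_monoidHom (Multiplicative (ℤ × ℤ)) F).comp χ hχ
  rw [Fintype.linearIndependent_iff] at hli
  refine hc (hli (fun i => c i) ?_ ⟨i₀, hi₀⟩)
  funext g
  have := h g.toAdd.1 g.toAdd.2
  rw [← Finset.sum_coe_sort S] at this
  simpa [χ, mul_assoc] using this

open Complex in
/-- The mean of a character over the circle. -/
theorem integral_exp_mul_I_zpow (k : ℤ) :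
    ∫ θ in (0 : ℝ)..2 * Real.pi, exp (θ * I) ^ k = if k = 0 then (2 * Real.pi : ℂ) else 0 := by
  split_ifs with hk
  · simp [hk]
  · have hc : (k : ℂ) * I ≠ 0 := mul_ne_zero (Int.cast_ne_zero.2 hk) I_ne_zero
    have h1 : ∀ θ : ℝ, exp (θ * I) ^ k = exp ((k : ℂ) * I * θ) := by
      intro θ
      rw [← exp_int_mul]
      ring_nf
    simp_rw [h1]
    rw [integral_exp_mul_complex hc]
    have h2 : (k : ℂ) * I * ((2 * Real.pi : ℝ) : ℂ) = k * (2 * Real.pi * I) := by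
      push_cast
      ring
    rw [h2, exp_int_mul_two_pi_mul_I]
    simp

open Complex in
/-- A Laplace type integral for the product of two binomials. -/
theorem integral_binomial_mul_binomial (r b b' : ℝ) (m n : ℕ) (hnm : n ≤ m) :
    ∫ θ in (0 : ℝ)..2 * Real.pi,
        ((r : ℂ) + b * exp (θ * I)) ^ m * ((r : ℂ) - b' * (exp (θ * I))⁻¹) ^ n =
      2 * Real.pi * ∑ j ∈ Finset.range (n + 1),
        (m.choose j * n.choose j * r ^ (m - j) * r ^ (n - j) * (-(b * b')) ^ j : ℂ) := by
  have hexp : ∀ θ : ℝ,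
      ((r : ℂ) + b * exp (θ * I)) ^ m * ((r : ℂ) - b' * (exp (θ * I))⁻¹) ^ n =
        ∑ j ∈ Finset.range (n + 1), ∑ i ∈ Finset.range (m + 1),
          (b ^ i * r ^ (m - i) * m.choose i * ((-b') ^ j * r ^ (n - j) * n.choose j) : ℂ) *
            exp (θ * I) ^ ((i : ℤ) - j) := by
    intro θ
    have he : exp (θ * I) ≠ 0 := exp_ne_zero _
    rw [add_comm (r : ℂ), add_pow, sub_eq_neg_add, add_pow, Finset.sum_mul_sum,
      Finset.sum_comm]
    refine Finset.sum_congr rfl fun j _ => Finset.sum_congr rfl fun i _ => ?_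
    rw [zpow_sub₀ he, zpow_natCast, zpow_natCast, mul_pow, ← neg_mul, mul_pow, inv_pow]
    field_simp
  simp_rw [hexp]
  have hcont : ∀ (c : ℂ) (k : ℤ), Continuous (fun θ : ℝ => c * exp (θ * I) ^ k) := fun c k =>
    continuous_const.mul (Continuous.zpow₀ (by fun_prop) k fun θ => Or.inl (exp_ne_zero _))
  rw [intervalIntegral.integral_finsetSum fun j _ =>
    (continuous_finsetSum _ fun i _ => hcont _ _).intervalIntegrable _ _, Finset.mul_sum]
  refine Finset.sum_congr rfl fun j hj => ?_
  rw [intervalIntegral.integral_finsetSum fun i _ => (hcont _ _).intervalIntegrable _ _]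
  have hjm : j ∈ Finset.range (m + 1) := by
    rw [Finset.mem_range] at hj ⊢
    omega
  rw [Finset.sum_eq_single_of_mem j hjm]
  · rw [intervalIntegral.integral_const_mul, integral_exp_mul_I_zpow, if_pos (sub_self _),
      neg_mul_eq_mul_neg, mul_pow]
    ring
  · intro i _ hij
    rw [intervalIntegral.integral_const_mul, integral_exp_mul_I_zpow,
      if_neg (sub_ne_zero.2 (by exact_mod_cast hij)), mul_zero]

/-- The polynomial in `y` whose value at `y = 1` is the radial part of a disc polynomial. -/
noncomputable def discSum (α m n : ℕ) (r y : ℝ) : ℝ :=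
  ∑ j ∈ Finset.range (n + 1), (m.choose j * n.choose j / (j + α).choose j *
    r ^ (m - j) * r ^ (n - j) * (-(1 - r ^ 2)) ^ j) * y ^ j

/-- Raising the parameter of `discSum` amounts to averaging over dilations. -/
theorem discSum_succ (α m n : ℕ) (r y : ℝ) :
    discSum (α + 1) m n r y = ∫ x in (0 : ℝ)..1, (α + 1) * x ^ α * discSum α m n r (x * y) := by
  unfold discSum
  simp_rw [Finset.mul_sum]
  rw [intervalIntegral.integral_finsetSum fun j _ =>
    Continuous.intervalIntegrable (by fun_prop) _ _]
  refine Finset.sum_congr rfl fun j _ => ?_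
  have h1 : ∀ x : ℝ, (α + 1) * x ^ α * ((m.choose j * n.choose j / (j + α).choose j *
      r ^ (m - j) * r ^ (n - j) * (-(1 - r ^ 2)) ^ j) * (x * y) ^ j) =
      ((α + 1) * ((m.choose j * n.choose j / (j + α).choose j *
      r ^ (m - j) * r ^ (n - j) * (-(1 - r ^ 2)) ^ j) * y ^ j)) * x ^ (α + j) := by
    intro x
    rw [mul_pow, pow_add]
    ring
  simp_rw [h1]
  rw [intervalIntegral.integral_const_mul, integral_pow]
  have h2 : ((j + (α + 1)).choose j : ℝ) * (α + 1) = (j + α).choose j * (α + j + 1) := by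
    have := Nat.choose_mul_succ_eq (j + α) j
    have h3 : j + α + 1 - j = α + 1 := by omega
    rw [h3] at this
    have h4 : ((j + α).choose j : ℝ) * (j + α + 1) = (j + α + 1).choose j * (α + 1) := by
      exact_mod_cast this
    rw [← add_assoc, ← h4]
    ring
  have hp1 : ((j + (α + 1)).choose j : ℝ) ≠ 0 := by
    exact_mod_cast (Nat.choose_pos (by omega)).ne'
  have hp2 : ((j + α).choose j : ℝ) ≠ 0 := by
    exact_mod_cast (Nat.choose_pos (by omega)).ne'
  have hp3 : (α + j + 1 : ℝ) ≠ 0 := by positivity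
  have h5 : (((j + (α + 1)).choose j : ℝ))⁻¹ = (α + 1) / ((j + α).choose j * (α + j + 1)) := by
    rw [← h2]
    field_simp
  simp only [div_eq_mul_inv, h5]
  push_cast
  field_simp
  simp

/-- A bound for `discSum` with parameter `0`, uniform in `y`, holds for every parameter. -/
theorem abs_discSum_le_of_zero {m n : ℕ} {r B : ℝ}
    (h : ∀ y ∈ Set.Icc (0 : ℝ) 1, |discSum 0 m n r y| ≤ B) (α : ℕ) :
    ∀ y ∈ Set.Icc (0 : ℝ) 1, |discSum α m n r y| ≤ B := by
  induction α with
  | zero => exact h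
  | succ α ih =>
    intro y hy
    rw [discSum_succ]
    have hb : ∀ x ∈ Set.Ioc (0 : ℝ) 1,
        ‖(α + 1) * x ^ α * discSum α m n r (x * y)‖ ≤ (α + 1) * x ^ α * B := by
      intro x hx
      have hx0 : 0 ≤ (α + 1 : ℝ) * x ^ α := by
        have := hx.1.le
        positivity
      rw [norm_mul, Real.norm_of_nonneg hx0]
      exact mul_le_mul_of_nonneg_left
        (ih _ ⟨mul_nonneg hx.1.le hy.1, mul_le_one₀ hx.2 hy.1 hy.2⟩) hx0
    have := intervalIntegral.norm_integral_le_of_norm_le (μ := MeasureTheory.volume) zero_le_one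
      (Filter.Eventually.of_forall hb) (Continuous.intervalIntegrable (by fun_prop) _ _)
    refine this.trans (le_of_eq ?_)
    rw [intervalIntegral.integral_mul_const, intervalIntegral.integral_const_mul, integral_pow]
    have : (α + 1 : ℝ) ≠ 0 := by positivity
    field_simp
    simp

/-- The choice of contour radii that makes the integrand of the Laplace type integral
bounded by one. -/
theorem exists_balanced_radii {r y : ℝ} (hr0 : 0 ≤ r) (hr1 : r ≤ 1) (hy : y ∈ Set.Icc (0 : ℝ) 1)
    {m n : ℕ} (hnm : n ≤ m) (hn : 0 < n) :
    ∃ b b' : ℝ, b ∈ Set.Icc (0 : ℝ) 1 ∧ b * b' = (1 - r ^ 2) * y ∧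
      ∀ x : ℝ, n * (r ^ 2 + b' ^ 2 - 2 * r * b' * x) ≤
        n - m * (r ^ 2 + b ^ 2 + 2 * r * b * x - 1) := by
  have hn' : (0 : ℝ) < n := by exact_mod_cast hn
  have hnm' : (n : ℝ) ≤ m := by exact_mod_cast hnm
  have hm' : (0 : ℝ) < m := hn'.trans_le hnm'
  have hr2 : r ^ 2 ≤ 1 := pow_le_one₀ hr0 hr1
  set A := (1 - r ^ 2) * y with hA
  have hA0 : 0 ≤ A := mul_nonneg (by linarith) hy.1
  have hA1 : A ≤ 1 - r ^ 2 := mul_le_of_le_one_right (by linarith) hy.2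
  set b := Real.sqrt (A * (n / m)) with hb
  have hb2 : b ^ 2 = A * (n / m) := Real.sq_sqrt (by positivity)
  have hle : A * (n / m) ≤ 1 := by
    have : (n / m : ℝ) ≤ 1 := (div_le_one hm').2 hnm'
    have h0 : (0 : ℝ) ≤ n / m := by positivity
    nlinarith [sq_nonneg r]
  refine ⟨b, b * (m / n), ⟨Real.sqrt_nonneg _, Real.sqrt_le_one.2 hle⟩, ?_, fun x => ?_⟩
  · rw [← mul_assoc, ← sq, hb2]
    field_simp
  · have e1 : (n : ℝ) * (r ^ 2 + (b * (m / n)) ^ 2 - 2 * r * (b * (m / n)) * x) =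
        n * r ^ 2 + A * m - 2 * r * b * m * x := by
      rw [mul_pow, hb2]
      field_simp
    have e2 : (n : ℝ) - m * (r ^ 2 + b ^ 2 + 2 * r * b * x - 1) =
        n - m * r ^ 2 - A * n - 2 * r * b * m * x + m := by
      rw [hb2]
      field_simp
      ring
    rw [e1, e2]
    nlinarith

theorem one_add_mul_one_add_sq_le_exp {δ : ℝ} (hδ : -1 ≤ δ) :
    (1 + δ) * (1 + δ ^ 2 / 27) ≤ Real.exp δ := by
  have h1 : 1 + δ / 3 ≤ Real.exp (δ / 3) := by linarith [Real.add_one_le_exp (δ / 3)]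
  have h2 : (1 + δ / 3) ^ 3 ≤ Real.exp (δ / 3) ^ 3 :=
    pow_le_pow_left₀ (by linarith) h1 3
  rw [← Real.exp_nat_mul] at h2
  have h3 : ((3 : ℕ) : ℝ) * (δ / 3) = δ := by
    push_cast
    ring
  rw [h3] at h2
  nlinarith [sq_nonneg δ]

theorem pow_mul_pow_le_one_div {u v : ℝ} (hu : 0 ≤ u) (hv : 0 ≤ v) {m n : ℕ}
    (h : n * v ≤ n - m * (u - 1)) (hn : 0 < n) :
    u ^ m * v ^ n ≤ 1 / (1 + m * ((u - 1) ^ 2 / 27)) := by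
  have hn' : (0 : ℝ) < n := by exact_mod_cast hn
  have hv1 : v ≤ Real.exp (-(m * (u - 1)) / n) := by
    refine le_trans ?_ (Real.add_one_le_exp _)
    rw [← sub_le_iff_le_add, le_div_iff₀ hn']
    linarith
  have hvn : v ^ n ≤ Real.exp (-(u - 1)) ^ m := by
    refine (pow_le_pow_left₀ hv hv1 n).trans (le_of_eq ?_)
    rw [← Real.exp_nat_mul, ← Real.exp_nat_mul]
    congr 1
    field_simp
  have hkey := one_add_mul_one_add_sq_le_exp (δ := u - 1) (by linarith)
  have hpos : (0 : ℝ) < 1 + (u - 1) ^ 2 / 27 := by positivity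
  have hu1 : u * Real.exp (-(u - 1)) ≤ 1 / (1 + (u - 1) ^ 2 / 27) := by
    rw [le_div_iff₀ hpos, Real.exp_neg]
    have := Real.exp_pos (u - 1)
    rw [mul_right_comm, ← div_eq_mul_inv, div_le_one this]
    linarith
  calc u ^ m * v ^ n ≤ u ^ m * Real.exp (-(u - 1)) ^ m :=
        mul_le_mul_of_nonneg_left hvn (pow_nonneg hu m)
    _ = (u * Real.exp (-(u - 1))) ^ m := (mul_pow _ _ _).symm
    _ ≤ (1 / (1 + (u - 1) ^ 2 / 27)) ^ m := by
        refine pow_le_pow_left₀ ?_ hu1 m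
        have := Real.exp_pos (-(u - 1))
        positivity
    _ = 1 / (1 + (u - 1) ^ 2 / 27) ^ m := by rw [one_div_pow]
    _ ≤ 1 / (1 + m * ((u - 1) ^ 2 / 27)) := by
        refine one_div_le_one_div_of_le (by positivity) ?_
        exact one_add_mul_le_pow (by have := sq_nonneg (u - 1); linarith) m

open Complex in
theorem sq_norm_add_mul_exp (r b θ : ℝ) :
    ‖(r : ℂ) + b * exp (θ * I)‖ ^ 2 = r ^ 2 + b ^ 2 + 2 * r * b * Real.cos θ := by
  rw [← normSq_eq_norm_sq, normSq_apply]
  simp only [add_re, add_im, mul_re, mul_im, ofReal_re, ofReal_im, exp_ofReal_mul_I_re,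
    exp_ofReal_mul_I_im]
  nlinarith [Real.sin_sq_add_cos_sq θ]

/-- The squared modulus of one factor of the Laplace type integrand, minus one. -/
noncomputable def radialDefect (r b θ : ℝ) : ℝ := r ^ 2 + b ^ 2 + 2 * r * b * Real.cos θ - 1

open Complex in
theorem abs_discSum_zero_le {r y : ℝ} (hr0 : 0 ≤ r) (hr1 : r ≤ 1) (hy : y ∈ Set.Icc (0 : ℝ) 1)
    {m n : ℕ} (hnm : n ≤ m) (hn : 0 < n) :
    ∃ b ∈ Set.Icc (0 : ℝ) 1, 2 * Real.pi * |discSum 0 m n r y| ≤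
      ∫ θ in (0 : ℝ)..2 * Real.pi, √(1 / (1 + m * (radialDefect r b θ ^ 2 / 27))) := by
  obtain ⟨b, b', hb, hbb, hx⟩ := exists_balanced_radii hr0 hr1 hy hnm hn
  refine ⟨b, hb, ?_⟩
  have hI := integral_binomial_mul_binomial r b b' m n hnm
  have hS : ∑ j ∈ Finset.range (n + 1),
      (m.choose j * n.choose j * r ^ (m - j) * r ^ (n - j) * (-(b * b')) ^ j : ℂ) =
        (discSum 0 m n r y : ℂ) := by
    unfold discSum
    push_cast
    refine Finset.sum_congr rfl fun j _ => ?_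
    have : (b * b' : ℂ) = (1 - r ^ 2) * y := by exact_mod_cast hbb
    rw [this, neg_mul_eq_neg_mul, mul_pow]
    simp
    ring
  rw [hS] at hI
  have hn1 : 2 * Real.pi * |discSum 0 m n r y| =
      ‖(2 * Real.pi * (discSum 0 m n r y : ℂ) : ℂ)‖ := by
    rw [norm_mul, norm_mul, norm_real, norm_real, Real.norm_eq_abs, Real.norm_eq_abs,
      abs_of_pos Real.pi_pos]
    simp
  rw [hn1, ← hI]
  have h2pi : (0 : ℝ) ≤ 2 * Real.pi := by positivity
  refine intervalIntegral.norm_integral_le_of_norm_le h2pi (Filter.Eventually.of_forall ?_) ?_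
  · intro θ _
    refine Real.le_sqrt_of_sq_le ?_
    have e2 : (r : ℂ) - b' * (exp (θ * I))⁻¹ = (r : ℂ) + ((-b' : ℝ) : ℂ) * exp ((-θ : ℝ) * I) := by
      rw [← exp_neg]
      push_cast
      ring_nf
    have h1 := sq_norm_add_mul_exp r b θ
    have h2 := sq_norm_add_mul_exp r (-b') (-θ)
    rw [← e2, Real.cos_neg] at h2
    rw [norm_mul, norm_pow, norm_pow, mul_pow, ← pow_mul, ← pow_mul, mul_comm m, mul_comm n,
      pow_mul, pow_mul]
    have := pow_mul_pow_le_one_div (m := m) (n := n)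
      (sq_nonneg ‖(r : ℂ) + b * exp (θ * I)‖) (sq_nonneg ‖(r : ℂ) - b' * (exp (θ * I))⁻¹‖)
      (by
        rw [h1, h2]
        have := hx (Real.cos θ)
        nlinarith) hn
    refine this.trans (le_of_eq ?_)
    rw [h1, radialDefect]
  · refine Continuous.intervalIntegrable (Continuous.sqrt (continuous_const.div ?_ ?_)) _ _
    · unfold radialDefect
      fun_prop
    · intro θ
      positivity

theorem abs_discSum_le_one {r : ℝ} (hr0 : 0 ≤ r) (hr1 : r ≤ 1) {m n : ℕ} (hnm : n ≤ m) (α : ℕ) :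
    |discSum α m n r 1| ≤ 1 := by
  refine abs_discSum_le_of_zero (fun y hy => ?_) α 1 ⟨zero_le_one, le_rfl⟩
  rcases Nat.eq_zero_or_pos n with rfl | hn
  · simpa [discSum, abs_of_nonneg hr0] using pow_le_one₀ hr0 hr1
  · obtain ⟨b, -, h⟩ := abs_discSum_zero_le hr0 hr1 hy hnm hn
    have h2pi : (0 : ℝ) < 2 * Real.pi := by positivity
    have hle : ∫ θ in (0 : ℝ)..2 * Real.pi, √(1 / (1 + m * (radialDefect r b θ ^ 2 / 27))) ≤
        1 * |2 * Real.pi - 0| := by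
      refine (Real.le_norm_self _).trans
        (intervalIntegral.norm_integral_le_of_norm_le_const fun θ _ => ?_)
      rw [Real.norm_of_nonneg (Real.sqrt_nonneg _), Real.sqrt_le_one]
      rw [div_le_one (by positivity)]
      have : (0 : ℝ) ≤ m * (radialDefect r b θ ^ 2 / 27) := by positivity
      linarith
    rw [sub_zero, abs_of_pos h2pi, one_mul] at hle
    exact le_of_mul_le_mul_left (by linarith) h2pi

open MeasureTheory in
theorem ae_radialDefect_ne_zero {r : ℝ} (hr0 : 0 < r) (hr1 : r < 1) (b : ℝ) :
    ∀ᵐ θ : ℝ, radialDefect r b θ ≠ 0 := by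
  have hc : {θ : ℝ | radialDefect r b θ = 0}.Countable := by
    rcases eq_or_ne b 0 with rfl | hb
    · convert Set.countable_empty
      ext θ
      simp only [radialDefect, Set.mem_ofPred_eq, Set.mem_empty_iff_false, iff_false]
      nlinarith
    · rcases Set.eq_empty_or_nonempty {θ : ℝ | radialDefect r b θ = 0} with he | ⟨θ₀, h₀⟩
      · rw [he]
        exact Set.countable_empty
      · refine (((Set.countable_range fun k : ℤ => 2 * k * Real.pi + θ₀)).union
          (Set.countable_range fun k : ℤ => 2 * k * Real.pi - θ₀)).mono ?_
        intro θ hθ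
        simp only [radialDefect, Set.mem_ofPred_eq] at hθ h₀
        have hcos : Real.cos θ₀ = Real.cos θ := by
          have : (2 * r * b) ≠ 0 := mul_ne_zero (by positivity) hb
          refine mul_left_cancel₀ this (by linarith)
        obtain ⟨k, hk | hk⟩ := Real.cos_eq_cos_iff.1 hcos
        · exact Or.inl ⟨k, hk.symm⟩
        · exact Or.inr ⟨k, hk.symm⟩
  exact hc.ae_notMem volume

open MeasureTheory Filter Topology in
theorem eventually_integral_radialDefect_le {r : ℝ} (hr0 : 0 < r) (hr1 : r < 1) {ε : ℝ}
    (hε : 0 < ε) :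
    ∀ᶠ h : ℝ in 𝓝 0, ∀ b ∈ Set.Icc (0 : ℝ) 1,
      ∫ θ in (0 : ℝ)..2 * Real.pi, √(|h| / (|h| + radialDefect r b θ ^ 2)) < ε := by
  refine isCompact_Icc.eventually_forall_of_forall_eventually fun b _ => ?_
  have hcont : ContinuousAt (fun z : ℝ × ℝ =>
      ∫ θ in (0 : ℝ)..2 * Real.pi, √(|z.1| / (|z.1| + radialDefect r z.2 θ ^ 2))) (0, b) := by
    refine intervalIntegral.continuousAt_of_dominated_interval (bound := fun _ => 1)
      (Eventually.of_forall fun z => ?_) (Eventually.of_forall fun z => ?_)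
      intervalIntegrable_const ?_
    · refine Measurable.aestronglyMeasurable ?_
      unfold radialDefect
      fun_prop
    · refine Eventually.of_forall fun θ _ => ?_
      rw [Real.norm_of_nonneg (Real.sqrt_nonneg _), Real.sqrt_le_one]
      exact div_le_one_of_le₀ (by have := sq_nonneg (radialDefect r z.2 θ); linarith)
        (by positivity)
    · filter_upwards [ae_radialDefect_ne_zero hr0 hr1 b] with θ hθ _
      refine ContinuousAt.sqrt (ContinuousAt.div (by fun_prop) ?_ ?_)
      · unfold radialDefect
        fun_prop
      · simpa using hθ
  refine hcont.eventually (gt_mem_nhds ?_)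
  simpa using hε

/-- Uniform decay of `discSum` inside the disc. -/
theorem exists_forall_abs_discSum_le {r : ℝ} (hr0 : 0 ≤ r) (hr1 : r < 1) {ε : ℝ} (hε : 0 < ε) :
    ∃ B : ℕ, ∀ α m n : ℕ, n ≤ m → B ≤ m - n → |discSum α m n r 1| ≤ ε := by
  rcases hr0.eq_or_lt with rfl | hr
  · refine ⟨1, fun α m n hnm hB => ?_⟩
    have : discSum α m n 0 1 = 0 := by
      refine Finset.sum_eq_zero fun j hj => ?_
      rw [Finset.mem_range] at hj
      have : m - j ≠ 0 := by omega
      simp [this]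
    simpa [this] using hε.le
  · have h2pi : (0 : ℝ) < 2 * Real.pi := by positivity
    have hev := eventually_integral_radialDefect_le hr hr1 (mul_pos h2pi hε)
    have ht : Filter.Tendsto (fun m : ℕ => 27 / (m : ℝ)) Filter.atTop (nhds 0) :=
      tendsto_const_div_atTop_nhds_zero_nat 27
    obtain ⟨B₁, hB₁⟩ := Filter.eventually_atTop.1 (ht.eventually hev)
    obtain ⟨B₂, hB₂⟩ := exists_pow_lt_of_lt_one hε hr1
    refine ⟨max (max B₁ B₂) 1, fun α m n hnm hB => ?_⟩
    have hm1 : B₁ ≤ m := by omega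
    have hm2 : B₂ ≤ m := by omega
    have hm0 : (0 : ℝ) < m := by
      have : 0 < m := by omega
      exact_mod_cast this
    refine abs_discSum_le_of_zero (fun y hy => ?_) α 1 ⟨zero_le_one, le_rfl⟩
    rcases Nat.eq_zero_or_pos n with rfl | hn
    · have : r ^ m ≤ ε := (pow_le_pow_of_le_one hr0 hr1.le hm2).trans hB₂.le
      simpa [discSum, abs_of_nonneg hr0] using this
    · obtain ⟨b, hb, h⟩ := abs_discSum_zero_le hr0 hr1.le hy hnm hn
      have h3 := hB₁ m hm1 b hb
      have h4 : ∀ θ : ℝ, |27 / (m : ℝ)| / (|27 / (m : ℝ)| + radialDefect r b θ ^ 2) =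
          1 / (1 + m * (radialDefect r b θ ^ 2 / 27)) := by
        intro θ
        rw [abs_of_pos (by positivity), div_eq_div_iff (by positivity) (by positivity)]
        field_simp
      simp_rw [h4] at h3
      exact le_of_mul_le_mul_left (h.trans h3.le) h2pi

theorem pow_mul_jacobiR_eq_discSum (α : ℕ) {m n : ℕ} (hnm : n ≤ m) (r : ℝ) :
    r ^ (m - n) * jacobiR α (m - n) n (2 * r ^ 2 - 1) = discSum α m n r 1 := by
  unfold jacobiR discSum
  rw [Finset.sum_div, Finset.mul_sum]
  refine Finset.sum_congr rfl fun j hj => ?_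
  have hjn : j ≤ n := by
    rw [Finset.mem_range] at hj
    omega
  have h1 : n + (m - n) = m := by omega
  have h2 : (2 * r ^ 2 - 1 - 1) / 2 = -(1 - r ^ 2) := by ring
  have h3 : (2 * r ^ 2 - 1 + 1) / 2 = r ^ 2 := by ring
  have h4 : r ^ (m - j) = r ^ (m - n) * r ^ (n - j) := by
    rw [← pow_add]
    congr 1
    omega
  have h5 : ((n + α).choose (n - j) : ℝ) * (j + α).choose j =
      n.choose j * (n + α).choose n := by
    have e1 := Nat.choose_mul (n := n + α) (k := n) (s := n - j) (by omega)
    have e2 : n + α - (n - j) = j + α := by omega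
    have e3 : n - (n - j) = j := by omega
    rw [e2, e3, Nat.choose_symm hjn] at e1
    rw [mul_comm (n.choose j : ℝ)]
    exact_mod_cast e1.symm
  have hp1 : ((n + α).choose n : ℝ) ≠ 0 := by
    exact_mod_cast (Nat.choose_pos (by omega)).ne'
  have hp2 : ((j + α).choose j : ℝ) ≠ 0 := by
    exact_mod_cast (Nat.choose_pos (by omega)).ne'
  have h6 : ((n + α).choose (n - j) : ℝ) = n.choose j * (n + α).choose n / (j + α).choose j := by
    rw [← h5]
    field_simp
  rw [h1, h2, h3, h4, h6, ← pow_mul, mul_comm 2 (n - j), pow_mul, one_pow]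
  field_simp

theorem norm_discR_eq {q : ℕ∞} (hq : ¬(q = ⊤ ∨ q ≤ 1)) (m n : ℕ) (ξ : ℂ) :
    ‖discR q m n ξ‖ = |discSum (q.toNat - 2) (max m n) (min m n) ‖ξ‖ 1| := by
  rw [discR, if_neg hq, norm_mul, Complex.norm_real, Real.norm_eq_abs,
    ← pow_mul_jacobiR_eq_discSum _ (min_le_max), abs_mul, abs_of_nonneg (a := ‖ξ‖ ^ _)
      (by positivity)]
  congr 1
  split_ifs with h
  · rw [norm_pow, max_eq_left h, min_eq_right h]
  · rw [norm_pow, RCLike.norm_conj, max_eq_right (by omega), min_eq_left (by omega)]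

theorem norm_discR_eq_pow {q : ℕ∞} (hq : q = ⊤ ∨ q ≤ 1) (m n : ℕ) (ξ : ℂ) :
    ‖discR q m n ξ‖ = ‖ξ‖ ^ (m + n) := by
  rw [discR, if_pos hq, norm_mul, norm_pow, norm_pow, RCLike.norm_conj, pow_add]

theorem norm_discR_le_one (q : ℕ∞) (m n : ℕ) {ξ : ℂ} (hξ : ‖ξ‖ ≤ 1) : ‖discR q m n ξ‖ ≤ 1 := by
  by_cases hq : q = ⊤ ∨ q ≤ 1
  · rw [norm_discR_eq_pow hq]
    exact pow_le_one₀ (norm_nonneg _) hξ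
  · rw [norm_discR_eq hq]
    exact abs_discSum_le_one (norm_nonneg _) hξ min_le_max _

/-- Disc polynomials decay inside the disc as `|m - n| → ∞`, uniformly in `min m n`. -/
theorem exists_forall_norm_discR_le (q : ℕ∞) {ξ : ℂ} (hξ : ‖ξ‖ < 1) {ε : ℝ} (hε : 0 < ε) :
    ∃ B : ℕ, ∀ m n : ℕ, (B : ℤ) ≤ |(m : ℤ) - n| → ‖discR q m n ξ‖ ≤ ε := by
  by_cases hq : q = ⊤ ∨ q ≤ 1
  · obtain ⟨B, hB⟩ := exists_pow_lt_of_lt_one hε hξ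
    refine ⟨B, fun m n h => ?_⟩
    rw [norm_discR_eq_pow hq]
    refine (pow_le_pow_of_le_one (norm_nonneg _) hξ.le ?_).trans hB.le
    rcases abs_cases ((m : ℤ) - n) with h' | h' <;> omega
  · obtain ⟨B, hB⟩ := exists_forall_abs_discSum_le (norm_nonneg ξ) hξ hε
    refine ⟨B, fun m n h => ?_⟩
    rw [norm_discR_eq hq]
    refine hB _ _ _ min_le_max ?_
    rcases abs_cases ((m : ℤ) - n) with h' | h' <;> omega

theorem discR_one (q : ℕ∞) (m n : ℕ) : discR q m n 1 = 1 := by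
  unfold discR
  split_ifs
  · simp
  all_goals
    have h : ∀ α β k : ℕ, jacobiR α β k (2 * ‖(1 : ℂ)‖ ^ 2 - 1) = 1 := by
      intro α β k
      have hp : ((k + α).choose k : ℝ) ≠ 0 := by
        exact_mod_cast (Nat.choose_pos (by omega)).ne'
      rw [jacobiR, Finset.sum_eq_single_of_mem 0 (by simp)]
      · norm_num
        exact_mod_cast hp
      · intro s _ hs
        norm_num [hs]
    rw [h]
    simp

theorem discR_unit_mul (q : ℕ∞) (m n : ℕ) {u : ℂ} (hu : ‖u‖ = 1) (ξ : ℂ) :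
    discR q m n (u * ξ) = u ^ ((m : ℤ) - n) * discR q m n ξ := by
  have hu0 : u ≠ 0 := by
    rintro rfl
    simp at hu
  have hconj : (starRingEnd ℂ) u = u⁻¹ := (Complex.inv_eq_conj hu).symm
  unfold discR
  split_ifs with h1 h2
  · rw [map_mul, hconj, zpow_sub₀ hu0, zpow_natCast, zpow_natCast, mul_pow, mul_pow, inv_pow]
    field_simp
  · have : (m : ℤ) - n = ((m - n : ℕ) : ℤ) := by omega
    rw [this, zpow_natCast, norm_mul, hu, one_mul, mul_pow]
    ring
  · have : (m : ℤ) - n = -((n - m : ℕ) : ℤ) := by omega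
    rw [this, zpow_neg, zpow_natCast, norm_mul, hu, one_mul, map_mul, hconj, mul_pow, inv_pow]
    ring

theorem hdot_smul_left (u : ℂ) (z w : Ell2) : hdot (u • z) w = u * hdot z w :=
  inner_smul_right _ _ _

theorem hdot_smul_right (u : ℂ) (z w : Ell2) : hdot z (u • w) = (starRingEnd ℂ) u * hdot z w :=
  inner_smul_left _ _ _

theorem hdot_self {q : ℕ∞} {z : Ell2} (hz : z ∈ Omega q) : hdot z z = 1 := by
  rw [hdot, inner_self_eq_norm_sq_to_K, hz.1]
  simp

theorem norm_hdot_le_one {q : ℕ∞} {z w : Ell2} (hz : z ∈ Omega q) (hw : w ∈ Omega q) :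
    ‖hdot z w‖ ≤ 1 := by
  refine (norm_inner_le_norm w z).trans ?_
  rw [hz.1, hw.1, one_mul]

theorem smul_mem_Omega {q : ℕ∞} {z : Ell2} (hz : z ∈ Omega q) {u : ℂ} (hu : ‖u‖ = 1) :
    u • z ∈ Omega q := by
  refine ⟨by rw [norm_smul, hu, hz.1, one_mul], fun j hj => ?_⟩
  rw [lp.coeFn_smul, Pi.smul_apply, hz.2 j hj, smul_zero]

/-- Unit vectors whose inner product has modulus one differ by a unit scalar. -/
theorem exists_unit_smul_of_norm_hdot {q : ℕ∞} {z w : Ell2} (hz : z ∈ Omega q) (hw : w ∈ Omega q)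
    (h : 1 ≤ ‖hdot z w‖) : ∃ u : ℂ, ‖u‖ = 1 ∧ z = u • w := by
  have hz0 : z ≠ 0 := by
    rintro rfl
    simpa using hz.1
  have hw0 : w ≠ 0 := by
    rintro rfl
    simpa using hw.1
  have h1 : ‖inner ℂ w z‖ = ‖w‖ * ‖z‖ := by
    rw [hz.1, hw.1, one_mul]
    exact le_antisymm (norm_hdot_le_one hz hw) h
  obtain ⟨u, -, hu⟩ := (norm_inner_eq_norm_iff hw0 hz0).1 h1
  refine ⟨u, ?_, hu⟩
  have := hz.1
  rwa [hu, norm_smul, hw.1, mul_one] at this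

theorem hdot_mem_domD {q : ℕ∞} {z w : Ell2} (hz : z ∈ Omega q) (hw : w ∈ Omega q) :
    hdot z w ∈ domD q := by
  unfold domD
  split_ifs with h
  · subst h
    have hin : ∀ z w : Ell2, z ∈ Omega 1 → hdot z w = z 0 * (starRingEnd ℂ) (w 0) := by
      intro z w hz
      rw [hdot, lp.inner_eq_tsum, tsum_eq_single 0]
      · simp
      · intro j hj
        rw [hz.2 j (by exact_mod_cast Nat.one_le_iff_ne_zero.2 hj)]
        simp
    have hnorm : ∀ z : Ell2, z ∈ Omega 1 → ‖z 0‖ = 1 := by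
      intro z hz
      have h1 := congrArg norm ((hin z z hz).symm.trans (hdot_self hz))
      rw [norm_mul, RCLike.norm_conj, norm_one] at h1
      nlinarith [norm_nonneg (z 0)]
    rw [mem_sphere_zero_iff_norm, hin z w hz, norm_mul, RCLike.norm_conj, hnorm z hz, hnorm w hw,
      one_mul]
  · rw [mem_closedBall_zero_iff]
    exact norm_hdot_le_one hz hw

theorem sum_sum_comp_eq {ι κ : Type*} [Fintype ι] [Fintype κ] [DecidableEq κ] (π : ι → κ)
    (c : ι → ℂ) (G : κ → κ → ℂ) :
    ∑ i, ∑ j, c i * (starRingEnd ℂ) (c j) * G (π i) (π j) =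
      ∑ k, ∑ l, (∑ i with π i = k, c i) * (starRingEnd ℂ) (∑ i with π i = l, c i) * G k l := by
  have h1 : ∀ g : ι → κ → ℂ, ∑ i, g i (π i) = ∑ k, ∑ i with π i = k, g i k := by
    intro g
    rw [← Finset.sum_fiberwise (s := Finset.univ) (g := π)]
    refine Finset.sum_congr rfl fun k _ => Finset.sum_congr rfl fun i hi => ?_
    rw [(Finset.mem_filter.1 hi).2]
  rw [h1 fun i k => ∑ j, c i * (starRingEnd ℂ) (c j) * G k (π j)]
  refine Finset.sum_congr rfl fun k _ => ?_
  rw [Finset.sum_comm, h1 fun j l => ∑ i with π i = k, c i * (starRingEnd ℂ) (c j) * G k l]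
  refine Finset.sum_congr rfl fun l _ => ?_
  rw [map_sum, Finset.sum_mul_sum, Finset.sum_comm]
  simp_rw [Finset.sum_mul]

/-- The defining inequality of a positive definite kernel holds for families with repetitions. -/
theorem IsPDKernel.sum_nonneg {α ι : Type*} [Fintype ι] {S : Set α} {K : α → α → ℂ}
    (h : IsPDKernel S K) (x : ι → α) (hx : ∀ i, x i ∈ S) (c : ι → ℂ) :
    0 ≤ ∑ i, ∑ j, c i * (starRingEnd ℂ) (c j) * K (x i) (x j) := by
  classical
  set T := Finset.univ.image x with hT
  let e := T.equivFin
  let π : ι → Fin T.card := fun i => e ⟨x i, Finset.mem_image_of_mem x (Finset.mem_univ i)⟩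
  let y : Fin T.card → α := fun k => (e.symm k : α)
  have hy : ∀ i, x i = y (π i) := by
    intro i
    simp [y, π]
  have hyS : ∀ k, y k ∈ S := by
    intro k
    obtain ⟨i, -, hi⟩ := Finset.mem_image.1 (e.symm k).2
    simpa [y, ← hi] using hx i
  simp_rw [hy]
  rw [sum_sum_comp_eq π c fun k l => K (y k) (y l)]
  exact h _ y hyS (Subtype.val_injective.comp e.symm.injective) _

/-- If the quadratic form of a positive definite function vanishes, it vanishes after rotating
the arguments. -/
theorem PDonProd.sum_rotate_eq_zero {q p : ℕ∞} {f : ℂ → ℂ → ℂ} (hPD : PDonProd q p f)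
    {L : ℕ} (x : Fin L → Ell2 × Ell2) (hx : ∀ i, x i ∈ Omega q ×ˢ Omega p) (c : Fin L → ℂ)
    (h0 : ∑ i, ∑ j, c i * (starRingEnd ℂ) (c j) *
      f (hdot (x i).1 (x j).1) (hdot (x i).2 (x j).2) = 0)
    {u v : ℂ} (hu : ‖u‖ = 1) (hv : ‖v‖ = 1) :
    ∑ i, ∑ j, c i * (starRingEnd ℂ) (c j) *
      f (u * hdot (x i).1 (x j).1) (v * hdot (x i).2 (x j).2) = 0 := by
  set Q : ℂ → ℂ → ℂ := fun u v => ∑ i, ∑ j, c i * (starRingEnd ℂ) (c j) *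
      f (u * hdot (x i).1 (x j).1) (v * hdot (x i).2 (x j).2) with hQ
  have hQ1 : Q 1 1 = 0 := by simpa [hQ] using h0
  have hcu : (starRingEnd ℂ) u * u = 1 := by
    rw [Complex.conj_mul', hu]
    simp
  have hcv : (starRingEnd ℂ) v * v = 1 := by
    rw [Complex.conj_mul', hv]
    simp
  have key : ∀ t : ℂ, 0 ≤ t * Q u v +
      (starRingEnd ℂ) t * Q ((starRingEnd ℂ) u) ((starRingEnd ℂ) v) := by
    intro t
    have h := IsPDKernel.sum_nonneg hPD
      (Sum.elim x fun i => (u • (x i).1, v • (x i).2))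
      (by
        rintro (i | i)
        · exact hx i
        · exact ⟨smul_mem_Omega (hx i).1 hu, smul_mem_Omega (hx i).2 hv⟩)
      (Sum.elim c fun i => t * c i)
    simp only [Fintype.sum_sum_type, Sum.elim_inl, Sum.elim_inr, hdot_smul_left,
      hdot_smul_right, ← mul_assoc, hcu, hcv, Finset.sum_add_distrib] at h
    convert h using 1
    have e1 : ∑ i, ∑ j, c i * (starRingEnd ℂ) (c j) *
        f (hdot (x i).1 (x j).1) (hdot (x i).2 (x j).2) = 0 := h0
    have e2 : ∑ i, ∑ j, t * c i * (starRingEnd ℂ) (t * c j) *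
        f (1 * hdot (x i).1 (x j).1) (1 * hdot (x i).2 (x j).2) = 0 := by
      have : ∑ i, ∑ j, t * c i * (starRingEnd ℂ) (t * c j) *
          f (1 * hdot (x i).1 (x j).1) (1 * hdot (x i).2 (x j).2) =
          t * (starRingEnd ℂ) t * Q 1 1 := by
        simp only [hQ, Finset.mul_sum, map_mul]
        exact Finset.sum_congr rfl fun i _ => Finset.sum_congr rfl fun j _ => by ring
      rw [this, hQ1, mul_zero]
    rw [e1, e2, zero_add, add_zero]
    simp only [hQ, Finset.mul_sum, map_mul]
    congr 1 <;>
      exact Finset.sum_congr rfl fun i _ => Finset.sum_congr rfl fun j _ => by ring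
  have zero_of : ∀ t : ℂ, t * Q u v +
      (starRingEnd ℂ) t * Q ((starRingEnd ℂ) u) ((starRingEnd ℂ) v) = 0 := by
    intro t
    refine le_antisymm ?_ (key t)
    have := key (-t)
    rw [map_neg, neg_mul, neg_mul, ← neg_add] at this
    exact neg_nonneg.1 this
  have h1 := zero_of 1
  have h2 := zero_of Complex.I
  rw [map_one] at h1
  rw [Complex.conj_I] at h2
  have h3 : 2 * Q u v = 0 := by
    linear_combination h1 - Complex.I * h2 + (Q u v - Q ((starRingEnd ℂ) u) ((starRingEnd ℂ) v)) *
      Complex.I_mul_I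
  simpa using h3

open Complex in
/-- Uniqueness of Fourier coefficients for an absolutely convergent trigonometric series. -/
theorem tsum_ite_eq_zero_of_forall_circle {ι : Type*} [Countable ι] (b : ι → ℂ)
    (hb : Summable fun i => ‖b i‖) (s : ι → ℤ)
    (h : ∀ u : ℂ, ‖u‖ = 1 → ∑' i, b i * u ^ s i = 0) (k : ℤ) :
    ∑' i, (if s i = k then b i else 0) = 0 := by
  have hnorm : ∀ θ : ℝ, ‖exp (θ * I)‖ = 1 := norm_exp_ofReal_mul_I
  have hcont : ∀ n : ℤ, Continuous (fun θ : ℝ => exp (θ * I) ^ n) := fun n =>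
    Continuous.zpow₀ (by fun_prop) n fun θ => Or.inl (exp_ne_zero _)
  have hS := intervalIntegral.hasSum_integral_of_dominated_convergence
    (μ := MeasureTheory.volume) (a := 0) (b := 2 * Real.pi)
    (F := fun i (θ : ℝ) => b i * exp (θ * I) ^ (s i - k)) (f := fun _ => 0)
    (fun i _ => ‖b i‖)
    (fun i => (continuous_const.mul (hcont _)).aestronglyMeasurable)
    (fun i => Filter.Eventually.of_forall fun θ _ => by
      simp [norm_zpow, hnorm])
    (Filter.Eventually.of_forall fun _ _ => hb)
    intervalIntegrable_const
    (Filter.Eventually.of_forall fun θ _ => by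
      have hs : Summable fun i => b i * exp (θ * I) ^ s i :=
        Summable.of_norm (by simpa [norm_mul, norm_zpow, hnorm] using hb)
      have h1 := hs.hasSum
      rw [h _ (hnorm θ)] at h1
      have h2 := h1.mul_right ((exp (θ * I) ^ k)⁻¹)
      rw [zero_mul] at h2
      have h3 : (fun i => b i * exp (θ * I) ^ (s i - k)) =
          fun i => b i * exp (θ * I) ^ s i * (exp (θ * I) ^ k)⁻¹ := funext fun i => by
        rw [zpow_sub₀ (exp_ne_zero _), div_eq_mul_inv, mul_assoc]
      exact h3 ▸ h2)
  simp only [intervalIntegral.integral_const_mul, integral_exp_mul_I_zpow, sub_eq_zero,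
    intervalIntegral.integral_zero, mul_ite, mul_zero] at hS
  have h2pi : (2 * Real.pi : ℂ) ≠ 0 := by
    exact_mod_cast (mul_pos two_pos Real.pi_pos).ne'
  have h3 := hS.mul_right (2 * Real.pi : ℂ)⁻¹
  rw [zero_mul] at h3
  have h4 : (fun i => if s i = k then b i else 0) =
      fun i => (if s i = k then b i * (2 * Real.pi : ℂ) else 0) * (2 * Real.pi : ℂ)⁻¹ :=
    funext fun i => by
      split_ifs
      · rw [mul_inv_cancel_right₀ h2pi]
      · rw [zero_mul]
  rw [h4]
  exact h3.tsum_eq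

/-- A Hermitian form with unit diagonal and small off-diagonal entries is coercive. -/
theorem half_sum_sq_le_re_of_small_offDiag {κ : Type*} [Fintype κ] (F : κ → ℂ) (R : κ → κ → ℂ)
    {ε : ℝ} (hε : 0 ≤ ε) (hcard : ε * Fintype.card κ ≤ 1 / 2) (hdiag : ∀ k, R k k = 1)
    (hoff : ∀ k l, k ≠ l → ‖R k l‖ ≤ ε) :
    1 / 2 * ∑ k, ‖F k‖ ^ 2 ≤ (∑ k, ∑ l, F k * (starRingEnd ℂ) (F l) * R k l).re := by
  classical
  have hterm : ∀ k l, (if k = l then ‖F k‖ ^ 2 else 0) - ε * (‖F k‖ * ‖F l‖) ≤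
      (F k * (starRingEnd ℂ) (F l) * R k l).re := by
    intro k l
    split_ifs with h
    · subst h
      rw [hdiag, mul_one, Complex.mul_conj, Complex.ofReal_re, Complex.normSq_eq_norm_sq]
      have : 0 ≤ ε * (‖F k‖ * ‖F k‖) := by positivity
      linarith
    · have h1 := Complex.abs_re_le_norm (F k * (starRingEnd ℂ) (F l) * R k l)
      rw [norm_mul, norm_mul, RCLike.norm_conj] at h1
      have h2 : ‖F k‖ * ‖F l‖ * ‖R k l‖ ≤ ‖F k‖ * ‖F l‖ * ε :=
        mul_le_mul_of_nonneg_left (hoff k l h) (by positivity)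
      linarith [neg_abs_le (F k * (starRingEnd ℂ) (F l) * R k l).re]
  have hsum := Finset.sum_le_sum fun k (_ : k ∈ Finset.univ) =>
    Finset.sum_le_sum fun l (_ : l ∈ Finset.univ) => hterm k l
  simp only [Finset.sum_sub_distrib, Finset.sum_ite_eq, Finset.mem_univ, if_true,
    ← Finset.mul_sum, ← Finset.sum_mul] at hsum
  have hcs : (∑ k, ‖F k‖) ^ 2 ≤ Fintype.card κ * ∑ k, ‖F k‖ ^ 2 := by
    simpa using sq_sum_le_card_mul_sum_sq (s := Finset.univ) (f := fun k => ‖F k‖)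
  have hΦ : 0 ≤ ∑ k, ‖F k‖ ^ 2 := Finset.sum_nonneg fun k _ => sq_nonneg _
  have h3 := mul_le_mul_of_nonneg_left hcs hε
  have h4 := mul_le_mul_of_nonneg_right hcard hΦ
  simp only [Complex.re_sum]
  rw [← sq] at hsum
  nlinarith

/-- Every residue class contains an arithmetic progression staying away from the origin. -/
theorem exists_subprogression (s₀ : ℤ) {N : ℤ} (hN : 0 < N) (B : ℕ) :
    ∃ M x : ℤ, 0 < M ∧ 0 < x ∧
      ∀ j : ℤ, (∃ k : ℤ, M * j + x = s₀ + N * k) ∧ (B : ℤ) ≤ |M * j + x| := by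
  set j₀ : ℤ := |s₀| + B + 1 with hj₀
  have habs := neg_abs_le s₀
  have hB : (0 : ℤ) ≤ B := Int.natCast_nonneg B
  have hj₀' : 0 ≤ j₀ := by positivity
  set x : ℤ := s₀ + N * j₀ with hx
  have hNj : j₀ ≤ N * j₀ := le_mul_of_one_le_left hj₀' hN
  have hxB : (B : ℤ) + 1 ≤ x := by linarith
  have hW : 0 < x + B := by linarith
  have hM : x + B ≤ N * (x + B) := le_mul_of_one_le_left hW.le hN
  refine ⟨N * (x + B), x, mul_pos hN hW, by linarith, fun j => ⟨⟨(x + B) * j + j₀, ?_⟩, ?_⟩⟩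
  · rw [hx]
    ring
  · rw [le_abs]
    rcases le_or_gt 0 j with hj | hj
    · left
      have : 0 ≤ N * (x + B) * j := mul_nonneg (by linarith) hj
      linarith
    · right
      have : N * (x + B) * j ≤ N * (x + B) * (-1) :=
        mul_le_mul_of_nonneg_left (by omega) (by linarith)
      linarith

/-- The kernel of a product of two disc polynomials. -/
def discKernel (q p : ℕ∞) (i : ℕ × ℕ × ℕ × ℕ) (x y : Ell2 × Ell2) : ℂ :=
  discR q i.1 i.2.1 (hdot x.1 y.1) * discR p i.2.2.1 i.2.2.2 (hdot x.2 y.2)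

/-- The weight `(m - n, k - l)` of the index `(m, n, k, l)`. -/
def weight (i : ℕ × ℕ × ℕ × ℕ) : ℤ × ℤ :=
  ((i.1 : ℤ) - (i.2.1 : ℤ), (i.2.2.1 : ℤ) - (i.2.2.2 : ℤ))

theorem norm_discKernel_le_one {q p : ℕ∞} (i : ℕ × ℕ × ℕ × ℕ) {x y : Ell2 × Ell2}
    (hx : x ∈ Omega q ×ˢ Omega p) (hy : y ∈ Omega q ×ˢ Omega p) :
    ‖discKernel q p i x y‖ ≤ 1 := by
  rw [discKernel, norm_mul]
  exact mul_le_one₀ (norm_discR_le_one q _ _ (norm_hdot_le_one hx.1 hy.1)) (norm_nonneg _)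
    (norm_discR_le_one p _ _ (norm_hdot_le_one hx.2 hy.2))

theorem discKernel_self {q p : ℕ∞} (i : ℕ × ℕ × ℕ × ℕ) {x : Ell2 × Ell2}
    (hx : x ∈ Omega q ×ˢ Omega p) : discKernel q p i x x = 1 := by
  rw [discKernel, hdot_self hx.1, hdot_self hx.2, discR_one, discR_one, one_mul]

theorem discKernel_smul_smul {q p : ℕ∞} (i : ℕ × ℕ × ℕ × ℕ) (x y : Ell2 × Ell2)
    {u v u' v' : ℂ} (hu : ‖u‖ = 1) (hv : ‖v‖ = 1) (hu' : ‖u'‖ = 1) (hv' : ‖v'‖ = 1) :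
    discKernel q p i (u • x.1, v • x.2) (u' • y.1, v' • y.2) =
      u ^ (weight i).1 * v ^ (weight i).2 *
        (starRingEnd ℂ) (u' ^ (weight i).1 * v' ^ (weight i).2) * discKernel q p i x y := by
  have hcu : ‖(starRingEnd ℂ) u'‖ = 1 := by rw [RCLike.norm_conj, hu']
  have hcv : ‖(starRingEnd ℂ) v'‖ = 1 := by rw [RCLike.norm_conj, hv']
  simp only [discKernel, weight, hdot_smul_left, hdot_smul_right, discR_unit_mul q _ _ hcu,
    discR_unit_mul q _ _ hu, discR_unit_mul p _ _ hcv, discR_unit_mul p _ _ hv, map_mul,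
    map_zpow₀]
  ring

/-- The kernels `discKernel` decay off the diagonal as both weights grow. -/
theorem exists_forall_norm_discKernel_le {q p : ℕ∞} {x y : Ell2 × Ell2}
    (hx : x ∈ Omega q ×ˢ Omega p) (hy : y ∈ Omega q ×ˢ Omega p)
    (hxy : ¬∃ u v : ℂ, ‖u‖ = 1 ∧ ‖v‖ = 1 ∧ x.1 = u • y.1 ∧ x.2 = v • y.2) {ε : ℝ} (hε : 0 < ε) :
    ∃ B : ℕ, ∀ i, (B : ℤ) ≤ |(weight i).1| → (B : ℤ) ≤ |(weight i).2| →
      ‖discKernel q p i x y‖ ≤ ε := by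
  by_cases h1 : ‖hdot x.1 y.1‖ < 1
  · obtain ⟨B, hB⟩ := exists_forall_norm_discR_le q h1 hε
    refine ⟨B, fun i hi _ => ?_⟩
    rw [discKernel, norm_mul]
    exact (mul_le_of_le_one_right (norm_nonneg _)
      (norm_discR_le_one p _ _ (norm_hdot_le_one hx.2 hy.2))).trans (hB _ _ hi)
  · have h2 : ‖hdot x.2 y.2‖ < 1 := by
      by_contra h2
      obtain ⟨u, hu, hxu⟩ := exists_unit_smul_of_norm_hdot hx.1 hy.1 (not_lt.1 h1)
      obtain ⟨v, hv, hxv⟩ := exists_unit_smul_of_norm_hdot hx.2 hy.2 (not_lt.1 h2)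
      exact hxy ⟨u, v, hu, hv, hxu, hxv⟩
    obtain ⟨B, hB⟩ := exists_forall_norm_discR_le p h2 hε
    refine ⟨B, fun i _ hi => ?_⟩
    rw [discKernel, norm_mul]
    exact (mul_le_of_le_one_left (norm_nonneg _)
      (norm_discR_le_one q _ _ (norm_hdot_le_one hx.1 hy.1))).trans (hB _ _ hi)

/-- The quadratic form of the kernel `discKernel q p i`. -/
def discForm (q p : ℕ∞) {L : ℕ} (x : Fin L → Ell2 × Ell2) (c : Fin L → ℂ)
    (i : ℕ × ℕ × ℕ × ℕ) : ℂ :=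
  ∑ μ, ∑ ν, c μ * (starRingEnd ℂ) (c ν) * discKernel q p i (x μ) (x ν)

theorem summable_norm_mul_discForm {q p : ℕ∞} {a : ℕ × ℕ × ℕ × ℕ → ℝ} (ha0 : ∀ i, 0 ≤ a i)
    (haS : Summable a) {L : ℕ} (x : Fin L → Ell2 × Ell2) (hx : ∀ i, x i ∈ Omega q ×ˢ Omega p)
    (c : Fin L → ℂ) : Summable fun i => ‖(a i : ℂ) * discForm q p x c i‖ := by
  refine Summable.of_nonneg_of_le (fun i => norm_nonneg _) (fun i => ?_)
    (haS.mul_right (∑ μ, ∑ ν, ‖c μ‖ * ‖c ν‖))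
  rw [norm_mul, Complex.norm_real, Real.norm_of_nonneg (ha0 i)]
  refine mul_le_mul_of_nonneg_left ?_ (ha0 i)
  refine norm_sum_le_of_le _ fun μ _ => norm_sum_le_of_le _ fun ν _ => ?_
  rw [norm_mul, norm_mul, RCLike.norm_conj]
  exact mul_le_of_le_one_right (by positivity) (norm_discKernel_le_one i (hx μ) (hx ν))

/-- If the quadratic form of `f` vanishes, so does each of its isotypic components. -/
theorem tsum_weight_eq_zero {q p : ℕ∞} {f : ℂ → ℂ → ℂ} (hPD : PDonProd q p f)
    {a : ℕ × ℕ × ℕ × ℕ → ℝ} (ha0 : ∀ i, 0 ≤ a i) (haS : Summable a)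
    (hexp : ∀ ξ ∈ domD q, ∀ η ∈ domD p,
      f ξ η = ∑' i : ℕ × ℕ × ℕ × ℕ,
        (a i : ℂ) * discR q i.1 i.2.1 ξ * discR p i.2.2.1 i.2.2.2 η)
    {L : ℕ} (x : Fin L → Ell2 × Ell2) (hx : ∀ i, x i ∈ Omega q ×ˢ Omega p) (c : Fin L → ℂ)
    (h0 : ∑ i, ∑ j, c i * (starRingEnd ℂ) (c j) *
      f (hdot (x i).1 (x j).1) (hdot (x i).2 (x j).2) = 0) (w : ℤ × ℤ) :
    ∑' i, (if weight i = w then (a i : ℂ) * discForm q p x c i else 0) = 0 := by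
  have hsumm := summable_norm_mul_discForm ha0 haS x hx c
  have hrot : ∀ u v : ℂ, ‖u‖ = 1 → ‖v‖ = 1 →
      ∑' i, (a i : ℂ) * discForm q p x c i * v ^ (weight i).2 * u ^ (weight i).1 = 0 := by
    intro u v hu hv
    rw [← hPD.sum_rotate_eq_zero x hx c h0 hu hv]
    have hterm : ∀ μ ν, c μ * (starRingEnd ℂ) (c ν) *
        f (u * hdot (x μ).1 (x ν).1) (v * hdot (x μ).2 (x ν).2) =
        ∑' i, c μ * (starRingEnd ℂ) (c ν) *
          ((a i : ℂ) * v ^ (weight i).2 * u ^ (weight i).1 * discKernel q p i (x μ) (x ν)) := by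
      intro μ ν
      rw [← hdot_smul_left, ← hdot_smul_left,
        hexp _ (hdot_mem_domD (smul_mem_Omega (hx μ).1 hu) (hx ν).1) _
          (hdot_mem_domD (smul_mem_Omega (hx μ).2 hv) (hx ν).2), tsum_mul_left]
      congr 1
      refine tsum_congr fun i => ?_
      rw [hdot_smul_left, hdot_smul_left, discR_unit_mul q _ _ hu, discR_unit_mul p _ _ hv,
        discKernel, weight]
      ring
    have hs : ∀ μ ν, Summable fun i => c μ * (starRingEnd ℂ) (c ν) *
        ((a i : ℂ) * v ^ (weight i).2 * u ^ (weight i).1 * discKernel q p i (x μ) (x ν)) := by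
      intro μ ν
      refine Summable.mul_left _ (Summable.of_norm_bounded haS fun i => ?_)
      rw [norm_mul, norm_mul, norm_mul, norm_zpow, norm_zpow, hu, hv, one_zpow, one_zpow, mul_one,
        mul_one, Complex.norm_real, Real.norm_of_nonneg (ha0 i)]
      exact mul_le_of_le_one_right (ha0 i) (norm_discKernel_le_one i (hx μ) (hx ν))
    simp_rw [hterm]
    simp_rw [← Summable.tsum_finsetSum fun ν _ => hs _ ν]
    rw [← Summable.tsum_finsetSum fun μ _ => summable_sum fun ν _ => hs μ ν]
    refine tsum_congr fun i => ?_
    simp only [discForm, Finset.mul_sum, Finset.sum_mul]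
    exact Finset.sum_congr rfl fun μ _ => Finset.sum_congr rfl fun ν _ => by ring
  have hfst : ∀ v : ℂ, ‖v‖ = 1 →
      ∑' i, (if (weight i).1 = w.1 then (a i : ℂ) * discForm q p x c i else 0) *
        v ^ (weight i).2 = 0 := by
    intro v hv
    have := tsum_ite_eq_zero_of_forall_circle
      (fun i => (a i : ℂ) * discForm q p x c i * v ^ (weight i).2)
      (by simpa [norm_zpow, hv] using hsumm) (fun i => (weight i).1)
      (fun u hu => hrot u v hu hv) w.1
    simpa only [ite_mul, zero_mul] using this
  have hsnd := tsum_ite_eq_zero_of_forall_circle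
    (fun i => if (weight i).1 = w.1 then (a i : ℂ) * discForm q p x c i else 0)
    (by
      refine Summable.of_nonneg_of_le (fun i => norm_nonneg _) (fun i => ?_) hsumm
      split_ifs
      · exact le_rfl
      · rw [norm_zero]
        exact norm_nonneg _) (fun i => (weight i).2) hfst w.2
  refine (tsum_congr fun i => ?_).trans hsnd
  rw [← ite_and]
  exact if_congr (Prod.ext_iff.trans and_comm) rfl rfl

/-- Two points of a product of spheres are equivalent if their components agree up to unit
scalars. -/
def phaseSetoid {L : ℕ} (x : Fin L → Ell2 × Ell2) : Setoid (Fin L) where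
  r μ ν := ∃ u v : ℂ, ‖u‖ = 1 ∧ ‖v‖ = 1 ∧ (x μ).1 = u • (x ν).1 ∧ (x μ).2 = v • (x ν).2
  iseqv :=
    { refl := fun _ => ⟨1, 1, by simp, by simp, by simp, by simp⟩
      symm := by
        rintro μ ν ⟨u, v, hu, hv, h1, h2⟩
        have hu0 : u ≠ 0 := norm_ne_zero_iff.1 (by simp [hu])
        have hv0 : v ≠ 0 := norm_ne_zero_iff.1 (by simp [hv])
        exact ⟨u⁻¹, v⁻¹, by simp [hu], by simp [hv], by rw [h1, inv_smul_smul₀ hu0],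
          by rw [h2, inv_smul_smul₀ hv0]⟩
      trans := by
        rintro μ ν τ ⟨u, v, hu, hv, h1, h2⟩ ⟨u', v', hu', hv', h1', h2'⟩
        exact ⟨u * u', v * v', by simp [hu, hu'], by simp [hv, hv'], by rw [h1, h1', mul_smul],
          by rw [h2, h2', mul_smul]⟩ }

/-- Proposition 3.7 / `th_progr->spd`: if the set
`J' = {(m-n, k-l) : a_{m,n,k,l} > 0}` of a continuous PD function on `Ω_{2q} × Ω_{2p}`
intersects every product of full arithmetic progressions in ℤ, then `f` is SPD. -/
theorem stmt6 (q p : ℕ∞) (hq : 1 ≤ q) (hp : 1 ≤ p) (f : ℂ → ℂ → ℂ)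
    (hf : ContinuousOn (fun v : ℂ × ℂ => f v.1 v.2) (domD q ×ˢ domD p))
    (hPD : PDonProd q p f)
    (a : ℕ × ℕ × ℕ × ℕ → ℝ) (ha0 : ∀ i, 0 ≤ a i) (haS : Summable a)
    (hq1 : ∀ m n k l : ℕ, q = 1 → 0 < m * n → a (m, n, k, l) = 0)
    (hp1 : ∀ m n k l : ℕ, p = 1 → 0 < k * l → a (m, n, k, l) = 0)
    (hexp : ∀ ξ ∈ domD q, ∀ η ∈ domD p,
      f ξ η = ∑' i : ℕ × ℕ × ℕ × ℕ,
        (a i : ℂ) * discR q i.1 i.2.1 ξ * discR p i.2.2.1 i.2.2.2 η)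
    (hJ : MeetsAllProgressions
      {v : ℤ × ℤ | ∃ m n k l : ℕ, 0 < a (m, n, k, l) ∧
        v = ((m : ℤ) - (n : ℤ), (k : ℤ) - (l : ℤ))}) :
    SPDonProd q p f := by
  refine ⟨hPD, fun L x hx hinj c h0 => ?_⟩
  classical
  by_contra hc
  obtain ⟨μ₀, hμ₀⟩ := Function.ne_iff.1 hc
  let _ : Setoid (Fin L) := phaseSetoid x
  let κ := Quotient (phaseSetoid x)
  have hrep : ∀ μ : Fin L, ∃ u v : ℂ, ‖u‖ = 1 ∧ ‖v‖ = 1 ∧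
      (x μ).1 = u • (x (⟦μ⟧ : κ).out).1 ∧ (x μ).2 = v • (x (⟦μ⟧ : κ).out).2 :=
    fun μ => Setoid.symm (Quotient.mk_out (s := phaseSetoid x) μ)
  choose u v hu hv hxu hxv using hrep
  have hu0 : ∀ μ, u μ ≠ 0 := fun μ => norm_ne_zero_iff.1 (by simp [hu μ])
  have hv0 : ∀ μ, v μ ≠ 0 := fun μ => norm_ne_zero_iff.1 (by simp [hv μ])
  let F : ℤ × ℤ → κ → ℂ := fun w k =>
    ∑ μ with (⟦μ⟧ : κ) = k, c μ * u μ ^ w.1 * v μ ^ w.2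
  have hform : ∀ i, discForm q p x c i = ∑ k, ∑ l, F (weight i) k *
      (starRingEnd ℂ) (F (weight i) l) * discKernel q p i (x k.out) (x l.out) := by
    intro i
    rw [← sum_sum_comp_eq (fun μ => (⟦μ⟧ : κ))
      (fun μ => c μ * u μ ^ (weight i).1 * v μ ^ (weight i).2)
      fun k l => discKernel q p i (x k.out) (x l.out)]
    refine Finset.sum_congr rfl fun μ _ => Finset.sum_congr rfl fun ν _ => ?_
    have hμ : x μ = (u μ • (x (⟦μ⟧ : κ).out).1, v μ • (x (⟦μ⟧ : κ).out).2) :=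
      Prod.ext (hxu μ) (hxv μ)
    have hν : x ν = (u ν • (x (⟦ν⟧ : κ).out).1, v ν • (x (⟦ν⟧ : κ).out).2) :=
      Prod.ext (hxu ν) (hxv ν)
    have hker := discKernel_smul_smul (q := q) (p := p) i (x (⟦μ⟧ : κ).out) (x (⟦ν⟧ : κ).out)
      (hu μ) (hv μ) (hu ν) (hv ν)
    rw [← hμ, ← hν] at hker
    rw [hker]
    simp only [map_mul]
    ring
  obtain ⟨ε, hε, hεκ⟩ : ∃ ε : ℝ, 0 < ε ∧ ε * Fintype.card κ ≤ 1 / 2 := by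
    refine ⟨1 / (2 * (Fintype.card κ + 1)), by positivity, ?_⟩
    rw [div_mul_eq_mul_div, div_le_div_iff₀ (by positivity) two_pos]
    linarith
  have hoff : ∀ k l : κ, ∃ B : ℕ, k ≠ l → ∀ i, (B : ℤ) ≤ |(weight i).1| →
      (B : ℤ) ≤ |(weight i).2| → ‖discKernel q p i (x k.out) (x l.out)‖ ≤ ε := by
    intro k l
    by_cases hkl : k = l
    · exact ⟨0, fun h => absurd hkl h⟩
    · obtain ⟨B, hB⟩ := exists_forall_norm_discKernel_le (hx k.out) (hx l.out)
        (fun h => hkl (Quotient.out_equiv_out.1 h)) hε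
      exact ⟨B, fun _ => hB⟩
  choose B hB using hoff
  let B₀ : ℕ := ∑ k, ∑ l, B k l
  have hB₀ : ∀ k l, (B k l : ℤ) ≤ B₀ := fun k l => by
    have h1 : B k l ≤ ∑ l, B k l :=
      Finset.single_le_sum (f := fun l => B k l) (fun _ _ => Nat.zero_le _) (Finset.mem_univ l)
    have h2 : ∑ l, B k l ≤ B₀ := Finset.single_le_sum (f := fun k => ∑ l, B k l)
      (fun _ _ => Nat.zero_le _) (Finset.mem_univ k)
    exact_mod_cast h1.trans h2
  have hcoer : ∀ i, (B₀ : ℤ) ≤ |(weight i).1| → (B₀ : ℤ) ≤ |(weight i).2| →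
      1 / 2 * ∑ k, ‖F (weight i) k‖ ^ 2 ≤ (discForm q p x c i).re := by
    intro i h1 h2
    rw [hform]
    exact half_sum_sq_le_re_of_small_offDiag _ _ hε.le hεκ
      (fun k => discKernel_self i (hx _))
      fun k l hkl => hB k l hkl i ((hB₀ k l).trans h1) ((hB₀ k l).trans h2)
  have hvanish : ∀ i₀, 0 < a i₀ → (B₀ : ℤ) ≤ |(weight i₀).1| → (B₀ : ℤ) ≤ |(weight i₀).2| →
      ∀ k, F (weight i₀) k = 0 := by
    intro i₀ hi₀ h1 h2
    have hzero := tsum_weight_eq_zero hPD ha0 haS hexp x hx c h0 (weight i₀)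
    have hsumm : Summable fun i =>
        if weight i = weight i₀ then (a i : ℂ) * discForm q p x c i else 0 := by
      refine Summable.of_norm_bounded (summable_norm_mul_discForm ha0 haS x hx c) fun i => ?_
      split_ifs
      · exact le_rfl
      · rw [norm_zero]
        exact norm_nonneg _
    have hre := congrArg Complex.re hzero
    rw [Complex.re_tsum hsumm, Complex.zero_re] at hre
    have hΦ : 0 ≤ ∑ k, ‖F (weight i₀) k‖ ^ 2 := Finset.sum_nonneg fun k _ => sq_nonneg _
    have hnn : ∀ i, 0 ≤
        (if weight i = weight i₀ then (a i : ℂ) * discForm q p x c i else 0).re := by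
      intro i
      split_ifs with hw
      · rw [Complex.re_ofReal_mul]
        have := hcoer i (hw ▸ h1) (hw ▸ h2)
        rw [hw] at this
        exact mul_nonneg (ha0 i) (by linarith)
      · simp
    have hle := (Complex.reCLM.summable hsumm).le_tsum i₀ fun i _ => hnn i
    have hle' : (a i₀ : ℝ) * (discForm q p x c i₀).re ≤ 0 := by
      simpa [hre] using hle
    have hΦ0 : ∑ k, ‖F (weight i₀) k‖ ^ 2 = 0 := by
      have h3 := hcoer i₀ h1 h2
      have h4 : (discForm q p x c i₀).re ≤ 0 := by
        by_contra h
        exact absurd hle' (not_le.2 (mul_pos hi₀ (not_le.1 h)))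
      linarith
    intro k
    have := (Finset.sum_eq_zero_iff_of_nonneg fun k _ => sq_nonneg _).1 hΦ0 k (Finset.mem_univ k)
    simpa using this
  obtain ⟨s₀, t₀, hst⟩ := exists_expSum_ne_zero
    (Finset.univ.filter fun μ : Fin L => (⟦μ⟧ : κ) = ⟦μ₀⟧) c u v hu0 hv0
    (fun i hi j hj h1 h2 => by
      have hij : (⟦i⟧ : κ) = ⟦j⟧ :=
        (Finset.mem_filter.1 hi).2.trans (Finset.mem_filter.1 hj).2.symm
      refine hinj (Prod.ext ?_ ?_)
      · rw [hxu i, hxu j, h1, hij]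
      · rw [hxv i, hxv j, h2, hij])
    (i₀ := μ₀) (by simp) hμ₀
  obtain ⟨N, hN, hNne⟩ := exists_progression_expSum_ne_zero _ c u v hu0 hv0 s₀ t₀ hst
  obtain ⟨M₁, x₁, hM₁, hx₁, h₁⟩ := exists_subprogression s₀ (N := N) (by exact_mod_cast hN) B₀
  obtain ⟨M₂, x₂, hM₂, hx₂, h₂⟩ := exists_subprogression t₀ (N := N) (by exact_mod_cast hN) B₀
  obtain ⟨w, ⟨m, n, k, l, hpos, hw⟩, ⟨j₁, hj₁⟩, ⟨j₂, hj₂⟩⟩ := hJ M₁ M₂ x₁ x₂ hM₁ hM₂ hx₁ hx₂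
  obtain ⟨⟨k₁, hk₁⟩, hB₁⟩ := h₁ j₁
  obtain ⟨⟨k₂, hk₂⟩, hB₂⟩ := h₂ j₂
  have hweight : weight (m, n, k, l) = w := hw.symm
  have hF := hvanish (m, n, k, l) hpos (by rw [hweight, hj₁]; exact hB₁)
    (by rw [hweight, hj₂]; exact hB₂) ⟦μ₀⟧
  refine hNne k₁ k₂ ?_
  rw [← hk₁, ← hk₂, ← hj₁, ← hj₂, ← hweight]
  exact hF

end
end

section
/- Let q, p ∈ ℕ ∪ {∞} and let f be a continuous function which is positive definite on Ω_{2q} × Ω_{2p}. Then the following are equivalent: (i) f is strictly positive definite on Ω_{2q} × Ω_{2p}; (ii) for every finite set X which is the enhanced set associated to some antipodal free set Y ⊆ Ω_{2q} × Ω_{2p} and some finite sets Θ and Δ of angles in [0,2π), the matrix A_X = [f(z_μ·z_ν, w_μ·w_ν)]_{μ,ν} (indexed by the points of X) is positive definite. -/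
open scoped ComplexOrder

noncomputable section

/-- The Gram matrix of a strictly positive definite kernel along a finite family of distinct
points is positive definite. -/
theorem IsSPDKernel.posDef {α ι : Type*} [Finite ι] {S : Set α} {K : α → α → ℂ}
    (h : IsSPDKernel S K) {x : ι → α} (hx : ∀ i, x i ∈ S) (hinj : Function.Injective x) :
    (Matrix.of fun i j => K (x i) (x j)).PosDef := by
  obtain ⟨L, ⟨e⟩⟩ := Finite.exists_equiv_fin ι
  have hxe : Function.Injective (x ∘ e.symm) := hinj.comp e.symm.injective
  set M : Matrix (Fin L) (Fin L) ℂ := Matrix.of fun i j => K (x (e.symm i)) (x (e.symm j)) with hM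
  have form (c : Fin L → ℂ) : star c ⬝ᵥ M.mulVec c =
      ∑ μ, ∑ ν, star c μ * (starRingEnd ℂ) (star c ν) * K (x (e.symm μ)) (x (e.symm ν)) := by
    simp only [dotProduct, Matrix.mulVec, Finset.mul_sum, hM, Matrix.of_apply, Pi.star_apply,
      starRingEnd_apply, star_star]
    exact Finset.sum_congr rfl fun _ _ => Finset.sum_congr rfl fun _ _ => by ring
  have nonneg (c : Fin L → ℂ) : 0 ≤ star c ⬝ᵥ M.mulVec c := by
    rw [form]
    exact h.1 L (x ∘ e.symm) (fun i => hx _) hxe (star c)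
  have herm : M.IsHermitian := by
    rw [← Matrix.isSymmetric_toEuclideanLin_iff, LinearMap.isSymmetric_iff_inner_map_self_real]
    intro v
    have hv : inner ℂ v (Matrix.toEuclideanLin M v) = star v.ofLp ⬝ᵥ M.mulVec v.ofLp := by
      rw [EuclideanSpace.inner_eq_star_dotProduct, dotProduct_comm]
      rfl
    rw [← inner_conj_symm, hv]
    exact congrArg _ (Complex.conj_eq_iff_im.2 (Complex.nonneg_iff.1 (nonneg _)).2.symm)
  have hpos : M.PosDef := by
    refine .of_dotProduct_mulVec_pos herm fun c hc => lt_of_le_of_ne (nonneg c) fun h0 => hc ?_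
    rw [form] at h0
    exact star_eq_zero.1 (h.2 L (x ∘ e.symm) (fun i => hx _) hxe (star c) h0.symm)
  convert hpos.submatrix e.injective using 1
  ext i j
  simp [hM]

/-- If the Gram matrix of a kernel along a finite family is positive definite, then its
quadratic form vanishes only at `0`. -/
theorem eq_zero_of_posDef_gram {α ι : Type*} [Fintype ι] {K : α → α → ℂ} {x : ι → α}
    (h : (Matrix.of fun i j => K (x i) (x j)).PosDef) {c : ι → ℂ}
    (hc : ∑ μ, ∑ ν, c μ * (starRingEnd ℂ) (c ν) * K (x μ) (x ν) = 0) : c = 0 := by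
  by_contra hne
  have hpos := h.dotProduct_mulVec_pos (star_ne_zero.2 hne)
  refine hpos.ne' (Eq.trans ?_ hc)
  simp only [dotProduct, Matrix.mulVec, Finset.mul_sum, Matrix.of_apply, Pi.star_apply,
    starRingEnd_apply, star_star]
  exact Finset.sum_congr rfl fun _ _ => Finset.sum_congr rfl fun _ _ => by ring

theorem exists_mem_Ico_exp_mul_I_eq {u : ℂ} (hu : ‖u‖ = 1) :
    ∃ a ∈ Set.Ico (0 : ℝ) (2 * Real.pi), Complex.exp (a * Complex.I) = u := by
  obtain ⟨θ, rfl⟩ := (Complex.norm_eq_one_iff u).1 hu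
  refine ⟨toIcoMod Real.two_pi_pos 0 θ, toIcoMod_mem_Ico' _ _, ?_⟩
  rw [← self_sub_toIcoDiv_zsmul, Complex.exp_eq_exp_iff_exists_int]
  refine ⟨-toIcoDiv Real.two_pi_pos 0 θ, ?_⟩
  push_cast [zsmul_eq_mul]
  ring

theorem exp_mul_I_injOn_Ico :
    Set.InjOn (fun a : ℝ => Complex.exp (a * Complex.I)) (Set.Ico 0 (2 * Real.pi)) := by
  intro a ha b hb hab
  exact injOn_circleMap_of_abs_sub_le' (c := 0) one_ne_zero (by simp) ha hb
    (by simpa [circleMap] using hab)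

theorem norm_exp_smul {E : Type*} [NormedAddCommGroup E] [NormedSpace ℂ E] (a : ℝ) (z : E) :
    ‖Complex.exp (a * Complex.I) • z‖ = ‖z‖ := by
  rw [norm_smul, Complex.norm_exp_ofReal_mul_I, one_mul]

/-- A choice of one representative in each orbit of the circle acting on the unit sphere. -/
theorem exists_phase_representative (E : Type*) [NormedAddCommGroup E] [InnerProductSpace ℂ E] :
    ∃ (r : E → E) (a : E → ℝ),
      (∀ z, a z ∈ Set.Ico 0 (2 * Real.pi) ∧ Complex.exp (a z * Complex.I) • r z = z) ∧
      ∀ z w, ‖z‖ = 1 → ‖w‖ = 1 → r z = r w ∨ ‖inner ℂ (r w) (r z)‖ < 1 := by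
  let s : Setoid E :=
    { r := fun z w => ∃ u : ℂ, ‖u‖ = 1 ∧ u • w = z
      iseqv :=
        { refl := fun z => ⟨1, by simp⟩
          symm := by
            rintro z w ⟨u, hu, rfl⟩
            have : u ≠ 0 := by rintro rfl; simp at hu
            exact ⟨u⁻¹, by simp [hu], by simp [smul_smul, this]⟩
          trans := by
            rintro z w v ⟨u, hu, rfl⟩ ⟨u', hu', rfl⟩
            exact ⟨u * u', by simp [hu, hu'], by simp [smul_smul]⟩ } }
  let r : E → E := fun z => (Quotient.mk s z).out
  have hr (z : E) : s z (r z) := s.symm (Quotient.mk_out (s := s) z)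
  have ha (z : E) : ∃ a : ℝ, a ∈ Set.Ico 0 (2 * Real.pi) ∧
      Complex.exp (a * Complex.I) • r z = z := by
    obtain ⟨u, hu, huz⟩ := hr z
    obtain ⟨a, ha, rfl⟩ := exists_mem_Ico_exp_mul_I_eq hu
    exact ⟨a, ha, huz⟩
  choose a ha using ha
  have norm_r (z : E) : ‖r z‖ = ‖z‖ := by
    conv_rhs => rw [← (ha z).2, norm_exp_smul]
  refine ⟨r, a, ha, fun z w hz hw => or_iff_not_imp_right.2 fun hlt => ?_⟩
  have hrz : ‖r z‖ = 1 := (norm_r z).trans hz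
  have hrw : ‖r w‖ = 1 := (norm_r w).trans hw
  have hle : ‖inner ℂ (r w) (r z)‖ ≤ ‖r w‖ * ‖r z‖ := norm_inner_le_norm _ _
  have heq : ‖inner ℂ (r w) (r z)‖ = ‖r w‖ * ‖r z‖ := by
    refine le_antisymm hle ?_
    rw [hrz, hrw, one_mul]
    exact not_lt.1 hlt
  obtain ⟨u, -, hu⟩ := (norm_inner_eq_norm_iff (norm_ne_zero_iff.1 (by simp [hrw]))
    (norm_ne_zero_iff.1 (by simp [hrz]))).1 heq
  have hu1 : ‖u‖ = 1 := by
    have := congrArg norm hu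
    rwa [norm_smul, hrz, hrw, mul_one, eq_comm] at this
  have hzw : s z w := s.trans (s.trans (hr z) ⟨u, hu1, hu.symm⟩) (s.symm (hr w))
  exact congrArg Quotient.out (Quotient.sound (s := s) hzw)

theorem exp_smul_mem_Omega {q : ℕ∞} {z : Ell2} (a : ℝ) :
    Complex.exp (a * Complex.I) • z ∈ Omega q ↔ z ∈ Omega q := by
  simp only [Omega, Set.mem_ofPred_eq, norm_exp_smul, lp.coeFn_smul, Pi.smul_apply, smul_eq_mul,
    mul_eq_zero, Complex.exp_ne_zero, false_or]

/-- Unit vectors that differ by a phase have Hermitian product of modulus `1`. -/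
theorem norm_hdot_of_exp_smul_eq {z w : Ell2} (hz : ‖z‖ = 1) {a b : ℝ}
    (h : Complex.exp (a * Complex.I) • z = Complex.exp (b * Complex.I) • w) :
    ‖hdot z w‖ = 1 := by
  have hn : ‖hdot (Complex.exp (a * Complex.I) • z) (Complex.exp (b * Complex.I) • w)‖ =
      ‖hdot z w‖ := by
    simp only [hdot, inner_smul_left, inner_smul_right, norm_mul, RCLike.norm_conj,
      Complex.norm_exp_ofReal_mul_I, one_mul]
  rw [← hn, ← h, hdot, inner_self_eq_norm_sq_to_K, norm_exp_smul, hz]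
  simp

theorem eq_of_exp_smul_eq {z : Ell2} (hz : ‖z‖ = 1) {a b : ℝ}
    (ha : a ∈ Set.Ico 0 (2 * Real.pi)) (hb : b ∈ Set.Ico 0 (2 * Real.pi))
    (h : Complex.exp (a * Complex.I) • z = Complex.exp (b * Complex.I) • z) : a = b :=
  exp_mul_I_injOn_Ico ha hb (smul_left_injective ℂ (norm_ne_zero_iff.1 (by simp [hz])) h)

/-- The points of an enhanced set are pairwise distinct. -/
theorem enhanced_injective {q p : ℕ∞} {ι κ ρ : Type*} {y : ι → Ell2 × Ell2}
    (hy : ∀ μ, y μ ∈ Omega q ×ˢ Omega p) (hinj : Function.Injective y)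
    (hanti : ∀ μ ν, μ ≠ ν →
      ((y μ).1 = (y ν).1 ∨ ‖hdot (y μ).1 (y ν).1‖ < 1) ∧
      ((y μ).2 = (y ν).2 ∨ ‖hdot (y μ).2 (y ν).2‖ < 1))
    {θ : κ → ℝ} (hθ : Function.Injective θ) (hθm : ∀ τ, θ τ ∈ Set.Ico 0 (2 * Real.pi))
    {δ : ρ → ℝ} (hδ : Function.Injective δ) (hδm : ∀ σ, δ σ ∈ Set.Ico 0 (2 * Real.pi)) :
    Function.Injective fun u : ι × κ × ρ =>
      (Complex.exp ((θ u.2.1 : ℂ) * Complex.I) • (y u.1).1,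
        Complex.exp ((δ u.2.2 : ℂ) * Complex.I) • (y u.1).2) := by
  rintro ⟨μ, τ, σ⟩ ⟨ν, τ', σ'⟩ huv
  obtain ⟨h1, h2⟩ := Prod.mk.inj huv
  have hz := (hy μ).1.1
  have hw := (hy μ).2.1
  obtain rfl : μ = ν := by
    by_contra hne
    refine hne (hinj (Prod.ext ?_ ?_))
    · exact (hanti μ ν hne).1.resolve_right (norm_hdot_of_exp_smul_eq hz h1).not_lt
    · exact (hanti μ ν hne).2.resolve_right (norm_hdot_of_exp_smul_eq hw h2).not_lt
  obtain rfl := hθ (eq_of_exp_smul_eq hz (hθm _) (hθm _) h1)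
  obtain rfl := hδ (eq_of_exp_smul_eq hw (hδm _) (hδm _) h2)
  rfl

/-- Every finite-range family is the reindexing of an injective family indexed by some `Fin n`. -/
theorem exists_injective_fin_reindex {ι α : Type*} [Finite ι] (g : ι → α) :
    ∃ (n : ℕ) (y : Fin n → α) (e : ι → Fin n),
      Function.Injective y ∧ (∀ i, y (e i) = g i) ∧ ∀ k, ∃ i, y k = g i := by
  obtain ⟨n, ⟨φ⟩⟩ := Finite.exists_equiv_fin (Set.range g)
  refine ⟨n, fun k => φ.symm k, fun i => φ ⟨g i, i, rfl⟩,
    Subtype.val_injective.comp φ.symm.injective, fun i => by simp, fun k => ?_⟩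
  obtain ⟨i, hi⟩ := (φ.symm k).2
  exact ⟨i, hi.symm⟩

/-- Lemma 3.8 / `lm_SDP_Xenh`: a continuous PD function `f` on
`Ω_{2q} × Ω_{2p}` is SPD iff for every enhanced set `X` associated to an antipodal free
set `Y` (with distinct points) and injective families of angles `θ, δ` in `[0, 2π)`,
the matrix `A_X = [f(z_μ·z_ν, w_μ·w_ν)]`, indexed by the points of `X`, is positive
definite. -/
theorem stmt13 (q p : ℕ∞) (hq : 1 ≤ q) (hp : 1 ≤ p) (f : ℂ → ℂ → ℂ)
    (hf : ContinuousOn (fun v : ℂ × ℂ => f v.1 v.2) (domD q ×ˢ domD p))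
    (hPD : PDonProd q p f) :
    SPDonProd q p f ↔
      ∀ (L t s : ℕ) (y : Fin L → Ell2 × Ell2),
        (∀ μ, y μ ∈ (Omega q) ×ˢ (Omega p)) → Function.Injective y →
        (∀ μ ν, μ ≠ ν →
          ((y μ).1 = (y ν).1 ∨ ‖hdot (y μ).1 (y ν).1‖ < 1) ∧
          ((y μ).2 = (y ν).2 ∨ ‖hdot (y μ).2 (y ν).2‖ < 1)) →
        ∀ θ : Fin t → ℝ, Function.Injective θ →
          (∀ τ, θ τ ∈ Set.Ico 0 (2 * Real.pi)) →
        ∀ δ : Fin s → ℝ, Function.Injective δ →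
          (∀ σ, δ σ ∈ Set.Ico 0 (2 * Real.pi)) →
        (Matrix.of fun u v : Fin L × Fin t × Fin s =>
          f (hdot (Complex.exp ((θ u.2.1 : ℂ) * Complex.I) • (y u.1).1)
                  (Complex.exp ((θ v.2.1 : ℂ) * Complex.I) • (y v.1).1))
            (hdot (Complex.exp ((δ u.2.2 : ℂ) * Complex.I) • (y u.1).2)
                  (Complex.exp ((δ v.2.2 : ℂ) * Complex.I) • (y v.1).2))).PosDef := by
  constructor
  · intro h L t s y hy hinj hanti θ hθ hθm δ hδ hδm
    exact IsSPDKernel.posDef (S := Omega q ×ˢ Omega p)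
      (K := fun u v : Ell2 × Ell2 => f (hdot u.1 v.1) (hdot u.2 v.2))
      (x := fun u : Fin L × Fin t × Fin s =>
        (Complex.exp ((θ u.2.1 : ℂ) * Complex.I) • (y u.1).1,
          Complex.exp ((δ u.2.2 : ℂ) * Complex.I) • (y u.1).2)) h
      (fun u => ⟨(exp_smul_mem_Omega _).2 (hy u.1).1, (exp_smul_mem_Omega _).2 (hy u.1).2⟩)
      (enhanced_injective hy hinj hanti hθ hθm hδ hδm)
  · refine fun h => ⟨hPD, fun L x hx hxinj c hc => ?_⟩
    obtain ⟨r, a, ha, hr⟩ := exists_phase_representative Ell2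
    have hrΩ {q : ℕ∞} {z : Ell2} (hz : z ∈ Omega q) : r z ∈ Omega q := by
      rw [← exp_smul_mem_Omega (a z), (ha z).2]
      exact hz
    obtain ⟨n, y, e, hy, hye, hyr⟩ :=
      exists_injective_fin_reindex fun i => (r (x i).1, r (x i).2)
    obtain ⟨t, θ, eθ, hθ, hθe, hθr⟩ := exists_injective_fin_reindex fun i => a (x i).1
    obtain ⟨s, δ, eδ, hδ, hδe, hδr⟩ := exists_injective_fin_reindex fun i => a (x i).2
    have hpos := h n t s y
      (fun μ => by
        obtain ⟨i, hi⟩ := hyr μ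
        rw [hi]
        exact ⟨hrΩ (hx i).1, hrΩ (hx i).2⟩)
      hy
      (fun μ ν _ => by
        obtain ⟨i, hi⟩ := hyr μ
        obtain ⟨j, hj⟩ := hyr ν
        rw [hi, hj]
        exact ⟨hr _ _ (hx i).1.1 (hx j).1.1, hr _ _ (hx i).2.1 (hx j).2.1⟩)
      θ hθ (fun τ => by obtain ⟨i, hi⟩ := hθr τ; rw [hi]; exact (ha _).1)
      δ hδ (fun σ => by obtain ⟨i, hi⟩ := hδr σ; rw [hi]; exact (ha _).1)
    have hE1 (i : Fin L) :
        Complex.exp ((θ (eθ i) : ℂ) * Complex.I) • (y (e i)).1 = (x i).1 := by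
      rw [hθe, hye, (ha _).2]
    have hE2 (i : Fin L) :
        Complex.exp ((δ (eδ i) : ℂ) * Complex.I) • (y (e i)).2 = (x i).2 := by
      rw [hδe, hye, (ha _).2]
    have hEinj : Function.Injective fun i => (e i, eθ i, eδ i) := by
      intro i j hij
      obtain ⟨h0, h12⟩ := Prod.mk.inj hij
      obtain ⟨h1, h2⟩ := Prod.mk.inj h12
      exact hxinj (Prod.ext (by rw [← hE1, h0, h1, hE1]) (by rw [← hE2, h0, h2, hE2]))
    refine eq_zero_of_posDef_gram
      (K := fun u v : Ell2 × Ell2 => f (hdot u.1 v.1) (hdot u.2 v.2)) (x := x) ?_ hc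
    convert hpos.submatrix hEinj using 1
    ext i j
    simp only [Matrix.submatrix_apply, Matrix.of_apply, hE1, hE2]

end
end

section
/- A continuous function f : 𝔻 × 𝔻 → ℂ is positive definite on Ω_∞ × Ω_∞ if, and only if, f is positive definite on Ω_{2q} × Ω_{2p} for every integers q, p ≥ 2. -/
open scoped ComplexOrder

noncomputable section

/-- The truncation of a sequence in ℓ² to its first `n` coordinates. -/
def ell2Trunc (n : ℕ) (z : Ell2) : Ell2 :=
  ∑ i ∈ Finset.range n, lp.single 2 i (z i)

theorem ell2Trunc_apply_of_le {n j : ℕ} (h : n ≤ j) (z : Ell2) : ell2Trunc n z j = 0 := by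
  rw [ell2Trunc, lp.coeFn_sum, Finset.sum_apply]
  refine Finset.sum_eq_zero fun i hi => ?_
  have hij : j ≠ i := by have := Finset.mem_range.mp hi; omega
  simp [lp.single_apply, hij]

theorem tendsto_ell2Trunc (z : Ell2) :
    Filter.Tendsto (fun n => ell2Trunc n z) Filter.atTop (nhds z) :=
  (lp.hasSum_single (by norm_num) z).tendsto_sum_nat

/-- The truncation of a sequence in ℓ² to its first `n` coordinates, rescaled to norm one. -/
def ell2Unit (n : ℕ) (z : Ell2) : Ell2 :=
  ((‖ell2Trunc n z‖⁻¹ : ℝ) : ℂ) • ell2Trunc n z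

theorem tendsto_ell2Unit {z : Ell2} (hz : ‖z‖ = 1) :
    Filter.Tendsto (fun n => ell2Unit n z) Filter.atTop (nhds z) := by
  have h := tendsto_ell2Trunc z
  have hn : Filter.Tendsto (fun n => ‖ell2Trunc n z‖⁻¹) Filter.atTop (nhds (1 : ℝ)) := by
    simpa [hz] using h.norm.inv₀ (by simp [hz])
  simpa [ell2Unit] using ((Complex.continuous_ofReal.tendsto 1).comp hn).smul h

theorem eventually_ell2Unit_mem_Omega {z : Ell2} (hz : ‖z‖ = 1) :
    ∀ᶠ n : ℕ in Filter.atTop, ell2Unit n z ∈ Omega n := by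
  have h : ∀ᶠ n in Filter.atTop, ell2Trunc n z ≠ 0 :=
    (tendsto_ell2Trunc z).eventually_ne (by rintro rfl; simp at hz)
  filter_upwards [h] with n hn
  refine ⟨?_, fun j hj => ?_⟩
  · rw [ell2Unit, norm_smul, Complex.norm_real, norm_inv, norm_norm,
      inv_mul_cancel₀ (norm_ne_zero_iff.mpr hn)]
  · simp [ell2Unit, ell2Trunc_apply_of_le (Nat.cast_le.mp hj)]

theorem Omega_mono {q q' : ℕ∞} (h : q ≤ q') : Omega q ⊆ Omega q' :=
  fun _ hz => ⟨hz.1, fun j hj => hz.2 j (h.trans hj)⟩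

theorem IsPDKernel.mono {α : Type*} {S T : Set α} {K : α → α → ℂ} (hK : IsPDKernel T K)
    (h : S ⊆ T) : IsPDKernel S K :=
  fun L x hx => hK L x fun i => h (hx i)

theorem hdot_mem_closedBall {z w : Ell2} (hz : ‖z‖ = 1) (hw : ‖w‖ = 1) :
    hdot z w ∈ Metric.closedBall (0 : ℂ) 1 := by
  rw [mem_closedBall_zero_iff]
  simpa [hdot, hz, hw] using norm_inner_le_norm (𝕜 := ℂ) w z

theorem Filter.Tendsto.hdot {ι : Type*} {l : Filter ι} {u v : ι → Ell2} {z w : Ell2}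
    (hu : Filter.Tendsto u l (nhds z)) (hv : Filter.Tendsto v l (nhds w)) :
    Filter.Tendsto (fun i => hdot (u i) (v i)) l (nhds (hdot z w)) :=
  Filter.Tendsto.inner hv hu

/-- Positive definiteness passes to limits of point configurations along which the kernel
converges. -/
theorem IsPDKernel.of_tendsto {α ι : Type*} [TopologicalSpace α] [T2Space α] {l : Filter ι}
    [l.NeBot] {S : Set α} {T : ι → Set α} {K : α → α → ℂ} (φ : ι → α → α)
    (hT : ∀ᶠ i in l, IsPDKernel (T i) K)
    (hmem : ∀ x ∈ S, ∀ᶠ i in l, φ i x ∈ T i)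
    (hφ : ∀ x ∈ S, Filter.Tendsto (fun i => φ i x) l (nhds x))
    (hK : ∀ x ∈ S, ∀ y ∈ S, Filter.Tendsto (fun i => K (φ i x) (φ i y)) l (nhds (K x y))) :
    IsPDKernel S K := by
  intro L x hx hinj c
  have hlim : Filter.Tendsto
      (fun i => ∑ μ, ∑ ν, c μ * (starRingEnd ℂ) (c ν) * K (φ i (x μ)) (φ i (x ν))) l
      (nhds (∑ μ, ∑ ν, c μ * (starRingEnd ℂ) (c ν) * K (x μ) (x ν))) :=
    tendsto_finsetSum _ fun μ _ => tendsto_finsetSum _ fun ν _ =>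
      (hK _ (hx μ) _ (hx ν)).const_mul _
  have hinj' : ∀ᶠ i in l, ∀ μ ν, μ ≠ ν → φ i (x μ) ≠ φ i (x ν) := by
    simp only [Filter.eventually_all]
    intro μ ν hμν
    exact ((hφ _ (hx μ)).prodMk_nhds (hφ _ (hx ν))).eventually
      (isClosed_diagonal.isOpen_compl.mem_nhds (hinj.ne hμν))
  refine ge_of_tendsto hlim ?_
  filter_upwards [hT, Filter.eventually_all.mpr fun μ => hmem _ (hx μ), hinj'] with i hi hm hn
  exact hi L (fun μ => φ i (x μ)) hm (fun μ ν h => by_contra fun hne => hn μ ν hne h) c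

/-- a continuous `f : 𝔻 × 𝔻 → ℂ` is PD on `Ω_∞ × Ω_∞` iff it is PD
on `Ω_{2q} × Ω_{2p}` for all integers `q, p ≥ 2`. -/
theorem stmt16 (f : ℂ → ℂ → ℂ)
    (hf : ContinuousOn (fun v : ℂ × ℂ => f v.1 v.2)
      (Metric.closedBall 0 1 ×ˢ Metric.closedBall 0 1)) :
    PDonProd ⊤ ⊤ f ↔
      ∀ q p : ℕ, 2 ≤ q → 2 ≤ p → PDonProd (q : ℕ∞) (p : ℕ∞) f := by
  refine ⟨fun h q p _ _ => h.mono (Set.prod_mono (Omega_mono le_top) (Omega_mono le_top)),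
    fun h => ?_⟩
  refine IsPDKernel.of_tendsto (l := Filter.atTop)
    (T := fun n : ℕ => Omega (n : ℕ∞) ×ˢ Omega (n : ℕ∞))
    (fun n x => (ell2Unit n x.1, ell2Unit n x.2)) ?_ ?_ ?_ ?_
  · filter_upwards [Filter.eventually_ge_atTop 2] with n hn using h n n hn hn
  · intro x hx
    filter_upwards [eventually_ell2Unit_mem_Omega hx.1.1, eventually_ell2Unit_mem_Omega hx.2.1]
      with n h₁ h₂ using ⟨h₁, h₂⟩
  · exact fun x hx => (tendsto_ell2Unit hx.1.1).prodMk_nhds (tendsto_ell2Unit hx.2.1)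
  · intro x hx y hy
    have hc := hf (hdot x.1 y.1, hdot x.2 y.2)
      ⟨hdot_mem_closedBall hx.1.1 hy.1.1, hdot_mem_closedBall hx.2.1 hy.2.1⟩
    refine hc.tendsto.comp (f := fun n => (hdot (ell2Unit n x.1) (ell2Unit n y.1),
      hdot (ell2Unit n x.2) (ell2Unit n y.2))) (tendsto_nhdsWithin_iff.mpr ⟨?_, ?_⟩)
    · exact ((tendsto_ell2Unit hx.1.1).hdot (tendsto_ell2Unit hy.1.1)).prodMk_nhds
        ((tendsto_ell2Unit hx.2.1).hdot (tendsto_ell2Unit hy.2.1))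
    · filter_upwards [eventually_ell2Unit_mem_Omega hx.1.1,
        eventually_ell2Unit_mem_Omega hx.2.1, eventually_ell2Unit_mem_Omega hy.1.1,
        eventually_ell2Unit_mem_Omega hy.2.1] with n h₁ h₂ h₃ h₄
      exact ⟨hdot_mem_closedBall h₁.1 h₃.1, hdot_mem_closedBall h₂.1 h₄.1⟩

end
end
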